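/- arXiv:1301.4603 — 3 statements merged into one kernel-verified Lean document; each statement's English description precedes it below -/
import Mathlib

section
/- Let F be ℝ or ℂ, let A ∈ F^{I×R}, B ∈ F^{J×R}, C ∈ F^{K×R}, and suppose the tensor T = [A,B,C]_R also equals [Ā,B̄, CΠΛ_C]_R, where Π is an R×R permutation matrix and Λ_C is a nonsingular R×R diagonal matrix (R is not assumed minimal). If max(min(k_A, k_B − 1), min(k_A − 1, k_B)) + k_C ≥ R + 1, then there exist nonsingular R×R diagonal matrices Λ_A and Λ_B such that Ā = AΠΛ_A, B̄ = BΠΛ_B, and Λ_A Λ_B Λ_C = I_R. -/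
open scoped Matrix
open MeasureTheory

variable {F : Type*} [RCLike F]

/-- The k-rank of a matrix: the largest `k` such that every subset of `k` columns is
linearly independent. -/
noncomputable def krank {I R : ℕ} (A : Matrix (Fin I) (Fin R) F) : ℕ :=
  sSup {k | k ≤ R ∧ ∀ s : Finset (Fin R), s.card = k →
    LinearIndependent F (fun r : {x // x ∈ s} => A.transpose r.1)}

/-- The tensor `[A,B,C]_R` with entries `t_{ijk} = ∑ r, a_r(i) b_r(j) c_r(k)`. -/
def pdTensor {I J K R : ℕ} (A : Matrix (Fin I) (Fin R) F) (B : Matrix (Fin J) (Fin R) F)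
    (C : Matrix (Fin K) (Fin R) F) : Fin I → Fin J → Fin K → F :=
  fun i j k => ∑ r, A i r * B j r * C k r

/-- `T = [A,B,C]_R` is a polyadic decomposition of `T` (columns are required nonzero). -/
def IsPD {I J K R : ℕ} (T : Fin I → Fin J → Fin K → F) (A : Matrix (Fin I) (Fin R) F)
    (B : Matrix (Fin J) (Fin R) F) (C : Matrix (Fin K) (Fin R) F) : Prop :=
  (∀ r, A.transpose r ≠ 0) ∧ (∀ r, B.transpose r ≠ 0) ∧ (∀ r, C.transpose r ≠ 0) ∧
    T = pdTensor A B C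

/-- The rank of a tensor: the minimal number of rank-1 terms in a PD. -/
noncomputable def tensorRank {I J K : ℕ} (T : Fin I → Fin J → Fin K → F) : ℕ :=
  sInf {R | ∃ A : Matrix (Fin I) (Fin R) F, ∃ B : Matrix (Fin J) (Fin R) F,
    ∃ C : Matrix (Fin K) (Fin R) F, IsPD T A B C}

/-- The CPD of `T` (with `R` terms) is (essentially) unique: any two PDs with `R` terms
coincide up to permutation and scaling. -/
def CPDUnique {I J K : ℕ} (T : Fin I → Fin J → Fin K → F) (R : ℕ) : Prop :=
  ∀ (A A' : Matrix (Fin I) (Fin R) F) (B B' : Matrix (Fin J) (Fin R) F)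
    (C C' : Matrix (Fin K) (Fin R) F), IsPD T A B C → IsPD T A' B' C' →
    ∃ σ : Equiv.Perm (Fin R), ∃ la lb lc : Fin R → F,
      (∀ r, la r * lb r * lc r = 1) ∧
      (∀ i r, A' i r = A i (σ r) * la r) ∧
      (∀ j r, B' j r = B j (σ r) * lb r) ∧
      (∀ k r, C' k r = C k (σ r) * lc r)

/-- The third factor matrix of `T` (with `R` terms) is (essentially) unique. -/
def ThirdFactorUnique {I J K : ℕ} (T : Fin I → Fin J → Fin K → F) (R : ℕ) : Prop :=
  ∀ (A A' : Matrix (Fin I) (Fin R) F) (B B' : Matrix (Fin J) (Fin R) F)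
    (C C' : Matrix (Fin K) (Fin R) F), IsPD T A B C → IsPD T A' B' C' →
    ∃ σ : Equiv.Perm (Fin R), ∃ lc : Fin R → F, (∀ r, lc r ≠ 0) ∧
      (∀ k r, C' k r = C k (σ r) * lc r)

/-- The `m`-th compound matrix: the matrix of all `m × m` minors of `A`, with rows and
columns indexed by the `m`-element index subsets (taken in increasing order). -/
noncomputable def compound {I R : ℕ} (m : ℕ) (A : Matrix (Fin I) (Fin R) F) :
    Matrix {s : Finset (Fin I) // s.card = m} {t : Finset (Fin R) // t.card = m} F :=
  fun s t => Matrix.det (Matrix.of fun i j : Fin m =>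
    A (s.1.orderIsoOfFin s.2 i).1 (t.1.orderIsoOfFin t.2 j).1)

/-- Khatri–Rao (column-wise Kronecker) product. -/
def khatriRao {α β γ : Type*} (A : Matrix α γ F) (B : Matrix β γ F) : Matrix (α × β) γ F :=
  fun p c => A p.1 c * B p.2 c

/-- A matrix has full column rank iff its columns are linearly independent. -/
def FullColRank {α γ : Type*} (M : Matrix α γ F) : Prop :=
  LinearIndependent F M.transpose

/-- The vector `d̂^(m)` of all products `d_{i₁} ⋯ d_{i_m}`, `i₁ < ⋯ < i_m`. -/
def hatVec {R : ℕ} (m : ℕ) (d : Fin R → F) : {t : Finset (Fin R) // t.card = m} → F :=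
  fun t => ∏ i ∈ t.1, d i

/-- Condition (Um) for the pair `(A, B)`. -/
def CondU {I J R : ℕ} (m : ℕ) (A : Matrix (Fin I) (Fin R) F)
    (B : Matrix (Fin J) (Fin R) F) : Prop :=
  ∀ d : Fin R → F,
    (khatriRao (compound m A) (compound m B)).mulVec (hatVec m d) = 0 → hatVec m d = 0

/-- Condition (Wm) for the triple `(A, B, C)`. -/
def CondW {I J K R : ℕ} (m : ℕ) (A : Matrix (Fin I) (Fin R) F)
    (B : Matrix (Fin J) (Fin R) F) (C : Matrix (Fin K) (Fin R) F) : Prop :=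
  ∀ d : Fin R → F, (∃ x : Fin K → F, d = C.transpose.mulVec x) →
    (khatriRao (compound m A) (compound m B)).mulVec (hatVec m d) = 0 → hatVec m d = 0

/-- Condition (Hm) for the pair `(A, B)`: `H_{AB}(δ) ≥ min(δ, m)` for `δ = 1, …, R`. -/
def CondH {I J R : ℕ} (m : ℕ) (A : Matrix (Fin I) (Fin R) F)
    (B : Matrix (Fin J) (Fin R) F) : Prop :=
  ∀ δ : ℕ, 1 ≤ δ → δ ≤ R → ∀ s : Finset (Fin R), s.card = δ →
    δ + min δ m ≤ (A.submatrix id (fun x : {y // y ∈ s} => x.1)).rank +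
      (B.submatrix id (fun x : {y // y ∈ s} => x.1)).rank

theorem aux_krank_mem {I R : ℕ} (A : Matrix (Fin I) (Fin R) F) :
    krank A ≤ R ∧ ∀ s : Finset (Fin R), s.card = krank A →
    LinearIndependent F (fun r : {x // x ∈ s} => A.transpose r.1) := by
  have := Nat.sSup_mem (s := {k | k ≤ R ∧ ∀ s : Finset (Fin R), s.card = k →
    LinearIndependent F (fun r : {x // x ∈ s} => A.transpose r.1)})
    ⟨0, Nat.zero_le _, fun s hs => by
      have : s = ∅ := Finset.card_eq_zero.mp hs
      subst this
      exact linearIndependent_empty_type⟩ ⟨R, fun k hk => hk.1⟩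
  exact this

/-- Dual vectors for a small set of columns. -/
theorem aux_dual {I R : ℕ} (A : Matrix (Fin I) (Fin R) F) (S : Finset (Fin R))
    (hS : S.card ≤ krank A) (r : Fin R) (hr : r ∈ S) :
    ∃ y : Fin I → F, ∑ i, A i r * y i = 1 ∧ ∀ s ∈ S, s ≠ r → ∑ i, A i s * y i = 0 := by
  obtain ⟨hR, hli⟩ := aux_krank_mem A
  obtain ⟨S', hSS', -, hc⟩ := Finset.exists_subsuperset_card_eq (Finset.subset_univ S) hS
    (by simpa using hR)
  have hl := hli S' hc
  have hnot := hl.notMem_span_image (s := {x | x.1 ≠ r}) (x := ⟨r, hSS' hr⟩) (by simp)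
  obtain ⟨f, hf1, hf2⟩ := Submodule.exists_le_ker_of_notMem hnot
  have key : ∀ v : Fin I → F, f v = ∑ i, v i * f (Pi.single i 1) := by
    intro v
    have := LinearMap.pi_apply_eq_sum_univ f v
    rw [this]
    refine Finset.sum_congr rfl fun i _ => ?_
    rw [smul_eq_mul]
    congr 2
    ext j
    simp [Pi.single_apply, eq_comm]
  have hne : f (A.transpose r) ≠ 0 := hf1
  refine ⟨fun i => f (Pi.single i 1) / f (A.transpose r), ?_, ?_⟩
  · have := key (A.transpose r)
    simp only [← mul_div_assoc, ← Finset.sum_div]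
    rw [div_eq_one_iff_eq hne]
    rw [this]; rfl
  · intro s hs hsr
    have h0 : f (A.transpose s) = 0 := by
      have : A.transpose s ∈ Submodule.span F
          ((fun r : {x // x ∈ S'} => A.transpose r.1) '' {x | x.1 ≠ r}) :=
        Submodule.subset_span ⟨⟨s, hSS' hs⟩, hsr, rfl⟩
      exact hf2 this
    have := key (A.transpose s)
    simp only [← mul_div_assoc, ← Finset.sum_div]
    rw [h0] at this
    rw [div_eq_zero_iff]
    left
    exact this.symm

theorem aux_main {I J K R : ℕ} (A A' : Matrix (Fin I) (Fin R) F) (B B' : Matrix (Fin J) (Fin R) F)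
    (C : Matrix (Fin K) (Fin R) F) (hB' : ∀ r, B'.transpose r ≠ 0)
    (h : ∀ i j k, ∑ r, A i r * B j r * C k r = ∑ r, A' i r * B' j r * C k r)
    (hk : min (krank A) (krank B - 1) + krank C ≥ R + 1) :
    ∃ l : Fin R → F, ∀ r, l r ≠ 0 ∧ (∀ j, B' j r = l r * B j r) ∧ (∀ i, A i r = l r * A' i r) := by
  obtain ⟨hBR, hBli⟩ := aux_krank_mem B
  have hCR := (aux_krank_mem C).1
  obtain ⟨m, hm⟩ : ∃ m, m + krank C = R + 1 := ⟨R + 1 - krank C, by omega⟩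
  have hm1 : 1 ≤ m := by omega
  have hmA : m ≤ krank A := by omega
  have hmB : m + 1 ≤ krank B := by omega
  -- contraction in the third mode
  have hd : ∀ S : Finset (Fin R), S.card = m → ∀ r ∈ S, ∃ d : Fin R → F, d r = 1 ∧
      ∀ i j, ∑ s ∈ S, A i s * B j s * d s = ∑ s ∈ S, A' i s * B' j s * d s := by
    intro S hS r hr
    have hrS : r ∉ Sᶜ := by simpa using hr
    obtain ⟨x, hx1, hx0⟩ := aux_dual C (insert r Sᶜ) (by
      rw [Finset.card_insert_of_notMem hrS, Finset.card_compl, hS, Fintype.card_fin]; omega) r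
      (Finset.mem_insert_self _ _)
    refine ⟨fun s => ∑ k, C k s * x k, hx1, fun i j => ?_⟩
    have hz : ∀ s ∉ S, ∑ k, C k s * x k = 0 := fun s hs =>
      hx0 s (by simp [hs]) (by rintro rfl; exact hs hr)
    rw [Finset.sum_subset (Finset.subset_univ S) (fun s _ hs => by
        simp only [hz s hs, mul_zero]),
      Finset.sum_subset (Finset.subset_univ S) (fun s _ hs => by
        simp only [hz s hs, mul_zero])]
    have e : ∀ (P : Matrix (Fin I) (Fin R) F) (Q : Matrix (Fin J) (Fin R) F),
        ∑ s, P i s * Q j s * ∑ k, C k s * x k = ∑ k, (∑ s, P i s * Q j s * C k s) * x k := by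
      intro P Q
      simp only [Finset.mul_sum, Finset.sum_mul]
      rw [Finset.sum_comm]
      simp only [mul_assoc]
    rw [e, e]
    simp only [h]
  -- spans of corresponding columns agree
  have hspan : ∀ S : Finset (Fin R), S.card = m → ∀ r ∈ S,
      B'.transpose r ∈ Submodule.span F (B.transpose '' (S : Set (Fin R))) := by
    intro S hS
    have hle : Submodule.span F (B.transpose '' (S : Set (Fin R))) ≤
        Submodule.span F (B'.transpose '' (S : Set (Fin R))) := by
      rw [Submodule.span_le]
      rintro _ ⟨r, hr, rfl⟩
      have hr : r ∈ S := hr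
      obtain ⟨d, hd1, hd2⟩ := hd S hS r hr
      obtain ⟨y, hy1, hy0⟩ := aux_dual A S (by omega) r hr
      have e : B.transpose r = ∑ s ∈ S, ((∑ i, A' i s * y i) * d s) • B'.transpose s := by
        ext j
        have e1 : ∀ (P : Matrix (Fin I) (Fin R) F) (Q : Matrix (Fin J) (Fin R) F),
            ∑ s ∈ S, ((∑ i, P i s * y i) * d s) * Q j s
              = ∑ i, (∑ s ∈ S, P i s * Q j s * d s) * y i := by
          intro P Q
          simp only [Finset.sum_mul]
          rw [Finset.sum_comm]
          refine Finset.sum_congr rfl fun i _ => Finset.sum_congr rfl fun s _ => ?_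
          ring
        rw [Finset.sum_apply]
        simp only [Pi.smul_apply, smul_eq_mul, Matrix.transpose_apply]
        rw [e1]
        simp only [← hd2]
        rw [← e1, Finset.sum_eq_single_of_mem r hr, hy1, hd1]
        · ring
        · intro s hs hsr
          rw [hy0 s hs hsr]; ring
      rw [SetLike.mem_coe, e]
      exact Submodule.sum_mem _ fun s hs => Submodule.smul_mem _ _
        (Submodule.subset_span ⟨s, hs, rfl⟩)
    have hli : LinearIndependent F (fun r : {x // x ∈ S} => B.transpose r.1) := by
      obtain ⟨S', hSS', -, hc⟩ := Finset.exists_subsuperset_card_eq (Finset.subset_univ S)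
        (show S.card ≤ krank B by omega) (by simpa using hBR)
      exact (hBli S' hc).comp (fun x : {x // x ∈ S} => (⟨x.1, hSS' x.2⟩ : {x // x ∈ S'}))
        (fun a b hab => Subtype.ext (congrArg (fun z => z.1) hab))
    have hr1 : ∀ M : Matrix (Fin J) (Fin R) F, M.transpose '' (S : Set (Fin R)) =
        Set.range (fun r : {x // x ∈ S} => M.transpose r.1) := by
      intro M; ext v
      constructor
      · rintro ⟨r, hr, rfl⟩
        exact ⟨⟨r, hr⟩, rfl⟩
      · rintro ⟨r, rfl⟩
        exact ⟨r.1, r.2, rfl⟩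
    have heq := Submodule.eq_of_le_of_finrank_le hle (by
      rw [hr1 B, hr1 B', finrank_span_eq_card hli]
      exact finrank_range_le_card _)
    intro r hr
    rw [heq]
    exact Submodule.subset_span ⟨r, hr, rfl⟩
  have hB : ∀ r, ∃ l : F, ∀ j, B' j r = l * B j r := by
    intro r
    obtain ⟨W, hrW, -, hW⟩ := Finset.exists_subsuperset_card_eq
      (Finset.subset_univ ({r} : Finset (Fin R))) (show _ ≤ m + 1 by simp)
      (by rw [Finset.card_univ, Fintype.card_fin]; omega)
    have hr : r ∈ W := hrW (by simp)
    have hin : ∀ t ∈ W, t ≠ r →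
        B'.transpose r ∈ Submodule.span F (B.transpose '' ((W.erase t : Finset _) : Set (Fin R))) :=
      fun t ht htr => hspan _ (by rw [Finset.card_erase_of_mem ht, hW]; rfl) r
        (Finset.mem_erase.mpr ⟨htr.symm, hr⟩)
    obtain ⟨t, ht, htr⟩ := Finset.exists_mem_ne (show 1 < W.card by omega) r
    have hinW : B'.transpose r ∈ Submodule.span F (B.transpose '' (W : Set (Fin R))) :=
      Submodule.span_mono (Set.image_mono (by
        exact_mod_cast Finset.erase_subset t W)) (hin t ht htr)
    have comb : ∀ (S : Finset (Fin R)) (v : Fin J → F),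
        v ∈ Submodule.span F (B.transpose '' (S : Set (Fin R))) →
        ∃ c : Fin R → F, ∀ j, v j = ∑ s ∈ S, c s * B j s := by
      intro S v hv
      obtain ⟨c, hc⟩ := (Submodule.mem_span_image_finset_iff_exists_fun F).mp hv
      classical
      refine ⟨fun s => if hs : s ∈ S then c ⟨s, hs⟩ else 0, fun j => ?_⟩
      rw [← hc, Finset.sum_apply, ← Finset.sum_coe_sort S]
      refine Finset.sum_congr rfl fun s _ => ?_
      simp
    have ev : ∀ (S : Finset (Fin R)) (c : Fin R → F) (y : Fin J → F),
        ∑ j, (∑ s ∈ S, c s * B j s) * y j = ∑ s ∈ S, c s * ∑ j, B j s * y j := by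
      intro S c y
      simp only [Finset.mul_sum, Finset.sum_mul]
      rw [Finset.sum_comm]
      simp only [mul_assoc]
    obtain ⟨c, hc⟩ := comb W _ hinW
    have hc0 : ∀ t ∈ W, t ≠ r → c t = 0 := by
      intro t ht htr
      obtain ⟨y, hy1, hy0⟩ := aux_dual B W (by omega) t ht
      obtain ⟨c', hc'⟩ := comb _ _ (hin t ht htr)
      have e1 := ev W c y
      have e2 := ev (W.erase t) c' y
      simp only [← hc] at e1
      simp only [← hc'] at e2
      rw [e1, Finset.sum_eq_single_of_mem t ht (fun s hs hst => by rw [hy0 s hs hst, mul_zero]),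
        hy1, mul_one, Finset.sum_eq_zero] at e2
      · exact e2
      · intro s hs
        rw [Finset.mem_erase] at hs
        rw [hy0 s hs.2 hs.1, mul_zero]
    refine ⟨c r, fun j => ?_⟩
    have := hc j
    rw [Finset.sum_eq_single_of_mem r hr (fun s hs hst => by rw [hc0 s hs hst, zero_mul])] at this
    exact this
  choose l hl using hB
  refine ⟨l, fun r => ⟨?_, hl r, ?_⟩⟩
  · intro h0
    apply hB' r
    ext j
    simp [hl, h0]
  · obtain ⟨S, hrS, -, hS⟩ := Finset.exists_subsuperset_card_eq
      (Finset.subset_univ ({r} : Finset (Fin R))) (show _ ≤ m by simpa using hm1)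
      (by rw [Finset.card_univ, Fintype.card_fin]; omega)
    have hr : r ∈ S := hrS (by simp)
    obtain ⟨d, hd1, hd2⟩ := hd S hS r hr
    obtain ⟨y, hy1, hy0⟩ := aux_dual B S (by omega) r hr
    intro i
    have e1 : ∀ (P : Fin R → F), ∑ j, (∑ s ∈ S, P s * B j s * d s) * y j = P r := by
      intro P
      have : ∑ j, (∑ s ∈ S, P s * B j s * d s) * y j
          = ∑ s ∈ S, (P s * d s) * ∑ j, B j s * y j := by
        simp only [Finset.mul_sum, Finset.sum_mul]
        rw [Finset.sum_comm]
        refine Finset.sum_congr rfl fun i _ => Finset.sum_congr rfl fun s _ => ?_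
        ring
      rw [this, Finset.sum_eq_single_of_mem r hr (fun s hs hst => by rw [hy0 s hs hst, mul_zero]),
        hy1, hd1]
      ring
    rw [← e1 (fun s => A i s), ← e1 (fun s => l s * A' i s)]
    refine Finset.sum_congr rfl fun j _ => ?_
    rw [hd2]
    congr 1
    refine Finset.sum_congr rfl fun s _ => ?_
    rw [hl]; ring

/-- Proposition 1.11: equality of PDs having the third factor matrix in
common, up to permutation and scaling. -/
theorem stmt_0 {I J K R : ℕ} (T : Fin I → Fin J → Fin K → F)
    (A Abar : Matrix (Fin I) (Fin R) F) (B Bbar : Matrix (Fin J) (Fin R) F)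
    (C : Matrix (Fin K) (Fin R) F)
    (σ : Equiv.Perm (Fin R)) (lc : Fin R → F) (hlc : ∀ r, lc r ≠ 0)
    (h1 : IsPD T A B C)
    (h2 : IsPD T Abar Bbar (Matrix.of fun k r => C k (σ r) * lc r))
    (hk : max (min (krank A) (krank B - 1)) (min (krank A - 1) (krank B)) + krank C ≥ R + 1) :
    ∃ la lb : Fin R → F, (∀ r, la r ≠ 0) ∧ (∀ r, lb r ≠ 0) ∧
      (∀ r, la r * lb r * lc r = 1) ∧
      (∀ i r, Abar i r = A i (σ r) * la r) ∧
      (∀ j r, Bbar j r = B j (σ r) * lb r) := by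
  obtain ⟨hA, hB, hC, hT⟩ := h1
  obtain ⟨hA', hB', hC', hT'⟩ := h2
  have h : ∀ i j k, ∑ r, A i r * B j r * C k r = ∑ r, (Abar i (σ.symm r) * lc (σ.symm r)) *
      Bbar j (σ.symm r) * C k r := by
    intro i j k
    have e : pdTensor A B C i j k = pdTensor Abar Bbar (Matrix.of fun k r => C k (σ r) * lc r) i j k
      := by rw [← hT, hT']
    simp only [pdTensor, Matrix.of_apply] at e
    rw [e, ← Equiv.sum_comp σ (fun r => (Abar i (σ.symm r) * lc (σ.symm r)) *
      Bbar j (σ.symm r) * C k r)]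
    refine Finset.sum_congr rfl fun r _ => ?_
    simp only [Equiv.symm_apply_apply]
    ring
  rcases le_max_iff.mp (le_refl (max (min (krank A) (krank B - 1)) (min (krank A - 1) (krank B))))
    with hm | hm
  · obtain ⟨l, hl⟩ := aux_main A (Matrix.of fun i r => Abar i (σ.symm r) * lc (σ.symm r))
      B (Matrix.of fun j r => Bbar j (σ.symm r)) C (fun r => hB' (σ.symm r)) h (by omega)
    refine ⟨fun r => (l (σ r) * lc r)⁻¹, fun r => l (σ r),
      fun r => inv_ne_zero (mul_ne_zero (hl _).1 (hlc r)), fun r => (hl _).1, fun r => ?_,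
      fun i r => ?_, fun j r => ?_⟩
    · have := (hl (σ r)).1
      have := hlc r
      field_simp
    · have h0 := (hl (σ r)).1
      have h1 := hlc r
      rw [(hl (σ r)).2.2 i]
      simp only [Matrix.of_apply, Equiv.symm_apply_apply]
      field_simp
    · have := (hl (σ r)).2.1 j
      simp only [Matrix.of_apply, Equiv.symm_apply_apply] at this
      rw [this, mul_comm]
  · obtain ⟨l, hl⟩ := aux_main B (Matrix.of fun j r => Bbar j (σ.symm r))
      A (Matrix.of fun i r => Abar i (σ.symm r) * lc (σ.symm r)) C
      (fun r h0 => hA' (σ.symm r) (by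
        ext i
        have := congrFun h0 i
        simpa [hlc] using this))
      (fun j i k => by
        have := h i j k
        calc _ = _ := Finset.sum_congr rfl fun r _ => by rw [mul_comm (B j r)]
          _ = _ := this
          _ = _ := Finset.sum_congr rfl fun r _ => by
            simp only [Matrix.of_apply]; ring)
      (by omega)
    refine ⟨fun r => l (σ r) * (lc r)⁻¹, fun r => (l (σ r))⁻¹,
      fun r => mul_ne_zero (hl _).1 (inv_ne_zero (hlc r)), fun r => inv_ne_zero (hl _).1, fun r => ?_,
      fun i r => ?_, fun j r => ?_⟩
    · have := (hl (σ r)).1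
      have := hlc r
      field_simp
    · have h1 := hlc r
      have := (hl (σ r)).2.1 i
      simp only [Matrix.of_apply, Equiv.symm_apply_apply] at this
      rw [← mul_assoc, mul_comm (A i _), ← this]
      field_simp
    · have h0 := (hl (σ r)).1
      rw [(hl (σ r)).2.2 j]
      simp only [Matrix.of_apply, Equiv.symm_apply_apply]
      field_simp
end

section
/- Let T = [A,B,C]_R with A ∈ F^{I×R}, B ∈ F^{J×R}, C ∈ F^{K×R}, and set m_C := R − r_C + 2. Assume: (i) max(min(k_A, k_B − 1), min(k_A − 1, k_B)) + k_C ≥ R + 1; (ii) condition (U m_C) holds for the pair (A,B). Then r_T = R and the CPD of T is unique. -/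
open scoped Matrix
open MeasureTheory

variable {F : Type*} [RCLike F]

theorem cauchyBinet_aux {k : Type*} [Field k] {m R : ℕ} (P Q : Matrix (Fin m) (Fin R) k)
    (d : Fin R → k) :
    Matrix.det (Matrix.of fun i j : Fin m => ∑ r, P i r * Q j r * d r) =
      ∑ t : {t : Finset (Fin R) // t.card = m},
        Matrix.det (Matrix.of fun i j : Fin m => P i (t.1.orderIsoOfFin t.2 j).1) *
        Matrix.det (Matrix.of fun i j : Fin m => Q i (t.1.orderIsoOfFin t.2 j).1) *
        ∏ i ∈ t.1, d i := by
  classical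
  set w : Fin R → Fin m → k := fun r j => Q j r * d r with hw
  have e1 : Matrix.det (Matrix.of fun i j : Fin m => ∑ r, P i r * Q j r * d r) =
      ∑ f : Fin m → Fin R, (∏ i, P i (f i)) * Matrix.det (Matrix.of fun i => w (f i)) := by
    have h0 : (Matrix.of fun i j : Fin m => ∑ r, P i r * Q j r * d r) =
        fun i => ∑ r, P i r • w r := by
      ext i j
      simp [hw, Finset.sum_apply, mul_assoc]
    rw [h0]
    have h1 := (Matrix.detRowAlternating (n := Fin m) (R := k)).toMultilinearMap.map_sum
      (fun i r => P i r • w r)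
    refine h1.trans ?_
    refine Finset.sum_congr rfl fun f _ => ?_
    exact (Matrix.detRowAlternating (n := Fin m) (R := k)).toMultilinearMap.map_smul_univ
      (fun i => P i (f i)) (fun i => w (f i))
  rw [e1]
  -- group by image
  have e2 : ∑ f : Fin m → Fin R, (∏ i, P i (f i)) * Matrix.det (Matrix.of fun i => w (f i)) =
      ∑ f ∈ Finset.univ.filter (fun f : Fin m → Fin R => (Finset.univ.image f).card = m),
        (∏ i, P i (f i)) * Matrix.det (Matrix.of fun i => w (f i)) := by
    symm
    refine Finset.sum_subset (Finset.subset_univ _) ?_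
    intro f _ hf
    have : ¬ Function.Injective f := by
      intro hi
      apply hf
      simp [Finset.card_image_of_injective _ hi]
    simp only [Function.Injective, not_forall] at this
    obtain ⟨a, b, hab, hne⟩ := this
    rw [Matrix.det_zero_of_row_eq hne, mul_zero]
    ext j; simp [hab]
  rw [e2]
  rw [← Finset.sum_fiberwise_of_maps_to (s := Finset.univ.filter (fun f : Fin m → Fin R => (Finset.univ.image f).card = m))
    (t := Finset.univ.filter (fun t : Finset (Fin R) => t.card = m))
    (g := fun f => Finset.univ.image f) (by intro f hf; simpa using hf)]
  rw [← Finset.sum_subtype_of_mem (p := fun t : Finset (Fin R) => t.card = m) _ (by simp)]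
  rw [Finset.subtype_eq_univ.2 (by simp)]
  refine Finset.sum_congr rfl ?_
  rintro ⟨t, ht⟩ _
  set e : Fin m → Fin R := fun j => (t.orderIsoOfFin ht j).1 with he
  have einj : Function.Injective e := fun a b h => by
    apply (t.orderIsoOfFin ht).injective
    exact Subtype.ext h
  have eimg : Finset.univ.image e = t := by
    ext r; simp only [Finset.mem_image, Finset.mem_univ, true_and]
    constructor
    · rintro ⟨j, rfl⟩; exact (t.orderIsoOfFin ht j).2
    · intro hr; exact ⟨(t.orderIsoOfFin ht).symm ⟨r, hr⟩,
        congrArg Subtype.val ((t.orderIsoOfFin ht).apply_symm_apply _)⟩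
  have e3 : Finset.filter (fun f : Fin m → Fin R => Finset.univ.image f = t)
      (Finset.univ.filter (fun f : Fin m → Fin R => (Finset.univ.image f).card = m)) =
      Finset.univ.image (fun s : Equiv.Perm (Fin m) => e ∘ s) := by
    ext f
    simp only [Finset.mem_filter, Finset.mem_univ, true_and, Finset.mem_image]
    constructor
    · rintro ⟨h1, h2⟩
      have hm : ∀ i, f i ∈ t := fun i => by rw [← h2]; simp
      have finj : Function.Injective f := by
        have : (Finset.univ.image f).card = (Finset.univ : Finset (Fin m)).card := by simp [h1]
        have := Finset.card_image_iff.1 this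
        simpa using this
      let g : Fin m → Fin m := fun i => (t.orderIsoOfFin ht).symm ⟨f i, hm i⟩
      have ginj : Function.Injective g := by
        intro a b h
        have := (t.orderIsoOfFin ht).symm.injective h
        exact finj (by simpa using this)
      refine ⟨Equiv.ofBijective g (Finite.injective_iff_bijective.1 ginj), ?_⟩
      funext i
      exact congrArg Subtype.val ((t.orderIsoOfFin ht).apply_symm_apply ⟨f i, hm i⟩)
    · rintro ⟨s, rfl⟩
      have : Finset.univ.image (e ∘ s) = t := by
        rw [← Finset.image_image, Finset.image_univ_equiv, eimg]
      exact ⟨by rw [this, ht], this⟩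
  rw [e3, Finset.sum_image]
  · have e4 : Matrix.det (Matrix.of fun i => w (e i)) =
        Matrix.det (Matrix.of fun i j : Fin m => Q i (e j)) * ∏ i ∈ t, d i := by
      rw [← eimg, Finset.prod_image (fun a _ b _ h => einj h), mul_comm,
        ← Matrix.det_transpose (Matrix.of fun i j : Fin m => Q i (e j)), ← Matrix.det_mul_column]
      congr 1
      ext i j; simp [hw, mul_comm]
    rw [mul_assoc, ← e4, ← Matrix.det_transpose (Matrix.of fun i j : Fin m => P i (e j)),
      Matrix.det_apply', Finset.sum_mul]
    refine Finset.sum_congr rfl fun s _ => ?_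
    have := Matrix.det_permute s (Matrix.of fun i => w (e i))
    have h5 : (Matrix.of fun i => w ((e ∘ s) i)) = (Matrix.of fun i => w (e i)).submatrix s id := by
      ext i j; simp
    rw [h5, this]
    simp only [Matrix.transpose_apply, Matrix.of_apply, Function.comp]
    ring
  · intro a _ b _ h
    ext i
    have := congrFun h i
    exact congrArg _ (einj this)


open Classical in
/-- number of the vectors `c r` lying in `U`. -/
noncomputable def cntIn {k V : Type*} [Field k] [AddCommGroup V] [Module k V] {R : ℕ}
    (c : Fin R → V) (U : Submodule k V) : ℕ :=
  (Finset.univ.filter fun r => c r ∈ U).card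

section
variable {k V : Type*} [Field k] [AddCommGroup V] [Module k V]

theorem cntIn_le {R : ℕ} (c : Fin R → V) (U : Submodule k V) : cntIn c U ≤ R := by
  classical
  refine (Finset.card_le_univ _).trans ?_
  simp

theorem cntIn_congr {R : ℕ} (c : Fin R → V) (U W : Submodule k V)
    (h : ∀ r, c r ∈ U ↔ c r ∈ W) : cntIn c U = cntIn c W := by
  classical
  unfold cntIn
  simp [h]

theorem cntIn_eq_iff {R : ℕ} (c : Fin R → V) (U : Submodule k V) :
    R ≤ cntIn c U ↔ ∀ r, c r ∈ U := by
  classical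
  unfold cntIn
  constructor
  · intro h r
    have h1 : (Finset.univ.filter fun r => c r ∈ U) = Finset.univ := by
      apply Finset.eq_univ_of_card
      apply le_antisymm (Finset.card_le_univ _)
      simpa using h
    have := Finset.mem_univ r
    rw [← h1] at this
    simpa using this
  · intro h
    simp [h]

theorem sup_span_eq_of_cover [FiniteDimensional k V] {U W : Submodule k V} (hUW : U ≤ W)
    (hd : Module.finrank k W = Module.finrank k U + 1) {v : V} (hv : v ∈ W) (hvU : v ∉ U) :
    U ⊔ Submodule.span k {v} = W := by
  apply Submodule.eq_of_le_of_finrank_eq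
  · exact sup_le hUW (by simpa using hv)
  · rw [Submodule.finrank_sup_span_singleton hvU, hd]

open Classical in
theorem cntIn_cover [FiniteDimensional k V] {R : ℕ} (c : Fin R → V) {U W : Submodule k V} (hUW : U ≤ W)
    (hd : Module.finrank k W = Module.finrank k U + 1) :
    cntIn c W = cntIn c U +
      ((Finset.univ.filter fun r => c r ∉ U).filter
        fun r => U ⊔ Submodule.span k {c r} = W).card := by
  unfold cntIn
  rw [← Finset.card_union_of_disjoint]
  · congr 1
    ext r
    simp only [Finset.mem_filter, Finset.mem_univ, true_and, Finset.mem_union]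
    constructor
    · intro h
      by_cases hU : c r ∈ U
      · exact Or.inl hU
      · exact Or.inr ⟨hU, sup_span_eq_of_cover hUW hd h hU⟩
    · rintro (h | ⟨_, h⟩)
      · exact hUW h
      · rw [← h]
        exact Submodule.mem_sup_right (Submodule.mem_span_singleton_self _)
  · rw [Finset.disjoint_left]
    intro r h1 h2
    simp only [Finset.mem_filter, Finset.mem_univ, true_and] at h1 h2
    exact h2.1 h1

open Classical in
theorem cntIn_compl {R : ℕ} (c : Fin R → V) (U : Submodule k V) :
    (Finset.univ.filter fun r => c r ∉ U).card + cntIn c U = R := by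
  unfold cntIn
  have := Finset.card_filter_add_card_filter_not (s := (Finset.univ : Finset (Fin R)))
    (fun r => c r ∈ U)
  simp only [Finset.card_univ, Fintype.card_fin] at this
  omega

theorem finrank_le_cntIn {R : ℕ} (c : Fin R → V) (U : Submodule k V)
    (hU : U = Submodule.span k (c '' {r | c r ∈ U})) : Module.finrank k U ≤ cntIn c U := by
  classical
  have h2 := finrank_span_finset_le_card (R := k)
    ((Finset.univ.filter fun r => c r ∈ U).image c)
  have h3 : ((((Finset.univ.filter fun r => c r ∈ U).image c) : Finset V) : Set V) =
    c '' {r | c r ∈ U} := by simp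
  rw [Set.finrank, h3, ← hU] at h2
  exact h2.trans (by unfold cntIn; exact Finset.card_image_le)

theorem flat_sup {R : ℕ} (c : Fin R → V) (U : Submodule k V)
    (hU : U = Submodule.span k (c '' {r | c r ∈ U})) (q : Fin R) :
    U ⊔ Submodule.span k {c q} =
      Submodule.span k (c '' {r | c r ∈ U ⊔ Submodule.span k {c q}}) := by
  apply le_antisymm
  · apply sup_le
    · conv_lhs => rw [hU]
      apply Submodule.span_mono
      apply Set.image_mono
      intro r hr
      exact Submodule.mem_sup_left hr
    · apply Submodule.span_mono
      rintro _ rfl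
      exact ⟨q, Submodule.mem_sup_right (Submodule.mem_span_singleton_self _), rfl⟩
  · rw [Submodule.span_le]
    rintro _ ⟨r, hr, rfl⟩
    exact hr

theorem perm_flat [FiniteDimensional k V] {R R' : ℕ} (δ : ℕ) (hδ : R = R' + δ) (c : Fin R → V) (c' : Fin R' → V)
    (H : ∀ φ : Module.Dual k V,
      Module.finrank k (Submodule.span k (Set.range c')) ≤ cntIn c' (LinearMap.ker φ) + 1 →
      cntIn c' (LinearMap.ker φ) + δ ≤ cntIn c (LinearMap.ker φ))
    (hS : ∀ r, c r ∈ Submodule.span k (Set.range c')) (n : ℕ) :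
    ∀ U : Submodule k V, U = Submodule.span k (c' '' {r | c' r ∈ U}) →
      Module.finrank k U + n + 1 = Module.finrank k (Submodule.span k (Set.range c')) →
      cntIn c' U + δ ≤ cntIn c U := by
  classical
  set S := Submodule.span k (Set.range c') with hSdef
  have hc'S : ∀ q, c' q ∈ S := fun q => Submodule.subset_span ⟨q, rfl⟩
  have out : ∀ U : Submodule k V, Module.finrank k U < Module.finrank k S → ∃ q, c' q ∉ U := by
    intro U hlt
    by_contra! hcon
    have : S ≤ U := by
      rw [hSdef, Submodule.span_le]
      rintro _ ⟨q, rfl⟩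
      exact hcon q
    have := Submodule.finrank_mono this
    omega
  have leS : ∀ U : Submodule k V, U = Submodule.span k (c' '' {r | c' r ∈ U}) → U ≤ S := by
    intro U hU
    rw [hU]
    exact Submodule.span_mono (Set.image_subset_range _ _)
  induction n with
  | zero =>
    intro U hU hd
    obtain ⟨q, hq⟩ := out U (by omega)
    obtain ⟨φ, hφq, hφU⟩ := Submodule.exists_le_ker_of_notMem hq
    have hUS := leS U hU
    have key : LinearMap.ker φ ⊓ S = U := by
      symm
      apply Submodule.eq_of_le_of_finrank_le (le_inf hφU hUS)
      have hlt : LinearMap.ker φ ⊓ S < S := by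
        refine lt_of_le_of_ne inf_le_right ?_
        intro h
        have : c' q ∈ LinearMap.ker φ ⊓ S := by rw [h]; exact hc'S q
        exact hφq (by simpa using this.1)
      have := Submodule.finrank_lt_finrank_of_lt hlt
      omega
    have k1 : cntIn c' (LinearMap.ker φ) = cntIn c' U := by
      apply cntIn_congr
      intro r
      rw [← key]
      exact ⟨fun h => ⟨h, hc'S r⟩, fun h => h.1⟩
    have k2 : cntIn c (LinearMap.ker φ) = cntIn c U := by
      apply cntIn_congr
      intro r
      rw [← key]
      exact ⟨fun h => ⟨h, hS r⟩, fun h => h.1⟩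
    have := H φ (by
      rw [k1]
      have := finrank_le_cntIn c' U hU
      omega)
    rwa [k1, k2] at this
  | succ n ih =>
    intro U hU hd
    set N' := Finset.univ.filter fun r => c' r ∉ U with hN'
    set N := Finset.univ.filter fun r => c r ∉ U with hN
    set f' : Fin R' → Submodule k V := fun r => U ⊔ Submodule.span k {c' r} with hf'
    set f : Fin R → Submodule k V := fun r => U ⊔ Submodule.span k {c r} with hf
    set T := N'.image f' with hT
    have hTd : ∀ W ∈ T, U ≤ W ∧ Module.finrank k W = Module.finrank k U + 1 ∧
        cntIn c' W + δ ≤ cntIn c W := by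
      intro W hW
      obtain ⟨q, hq, rfl⟩ := Finset.mem_image.1 hW
      have hq' : c' q ∉ U := by simpa [hN'] using hq
      have hd' : Module.finrank k (f' q) = Module.finrank k U + 1 :=
        Submodule.finrank_sup_span_singleton hq'
      refine ⟨le_sup_left, hd', ?_⟩
      apply ih _ (flat_sup c' U hU q)
      change Module.finrank k (f' q) + n + 1 = _
      omega
    have s1 : ∑ W ∈ T, (N'.filter fun r => f' r = W).card = N'.card :=
      (Finset.card_eq_sum_card_fiberwise (fun x hx => Finset.mem_image_of_mem _ hx)).symm
    have s2 : ∑ W ∈ T, (N.filter fun r => f r = W).card ≤ N.card := by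
      rw [Finset.sum_card_fiberwise_eq_card_filter]
      exact Finset.card_filter_le _ _
    have s3 : ∑ W ∈ T, (cntIn c' U + (N'.filter fun r => f' r = W).card + δ) ≤
        ∑ W ∈ T, (cntIn c U + (N.filter fun r => f r = W).card) := by
      apply Finset.sum_le_sum
      intro W hW
      obtain ⟨a1, a2, a3⟩ := hTd W hW
      rw [cntIn_cover c' a1 a2, cntIn_cover c a1 a2] at a3
      exact a3
    simp only [Finset.sum_add_distrib, Finset.sum_const, smul_eq_mul] at s3
    rw [s1] at s3
    have t1 : N'.card + cntIn c' U = R' := cntIn_compl c' U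
    have t2 : N.card + cntIn c U = R := cntIn_compl c U
    have p2 : 2 ≤ T.card := by
      obtain ⟨q, hq⟩ := out U (by omega)
      have hd' : Module.finrank k (f' q) = Module.finrank k U + 1 :=
        Submodule.finrank_sup_span_singleton hq
      obtain ⟨s, hs⟩ := out (f' q) (by omega)
      have hsU : c' s ∉ U := fun h => hs (Submodule.mem_sup_left h)
      have : 1 < T.card := by
        rw [Finset.one_lt_card]
        refine ⟨f' q, Finset.mem_image_of_mem _ (by simpa [hN'] using hq), f' s,
          Finset.mem_image_of_mem _ (by simpa [hN'] using hsU), ?_⟩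
        intro h
        apply hs
        rw [h]
        exact Submodule.mem_sup_right (Submodule.mem_span_singleton_self _)
      omega
    by_contra! hcon
    obtain ⟨p, hp⟩ : ∃ p, T.card = p + 2 := ⟨T.card - 2, by omega⟩
    rw [hp] at s3
    have : (p + 1) * (cntIn c U + 1) ≤ (p + 1) * (cntIn c' U + δ) :=
      Nat.mul_le_mul_left _ hcon
    nlinarith

theorem perm_lemma [FiniteDimensional k V] {R R' : ℕ} (hR : R' ≤ R) (hR2 : 2 ≤ R) (c : Fin R → V) (c' : Fin R' → V)
    (hc : ∀ r s, r ≠ s → LinearIndependent k ![c r, c s]) (hc' : ∀ q, c' q ≠ 0)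
    (H : ∀ φ : Module.Dual k V,
      Module.finrank k (Submodule.span k (Set.range c')) ≤ cntIn c' (LinearMap.ker φ) + 1 →
      cntIn c' (LinearMap.ker φ) + (R - R') ≤ cntIn c (LinearMap.ker φ)) :
    R' = R ∧ ∃ σ : Fin R' → Fin R, Function.Injective σ ∧
      ∃ l : Fin R' → k, ∀ q, l q ≠ 0 ∧ c' q = l q • c (σ q) := by
  classical
  set S := Submodule.span k (Set.range c') with hSdef
  have hc'S : ∀ q, c' q ∈ S := fun q => Submodule.subset_span ⟨q, rfl⟩
  have hS : ∀ r, c r ∈ S := by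
    intro r
    by_contra hr
    obtain ⟨φ, hφ, hφS⟩ := Submodule.exists_le_ker_of_notMem hr
    have h1 : R' ≤ cntIn c' (LinearMap.ker φ) :=
      (cntIn_eq_iff _ _).2 fun q => hφS (hc'S q)
    have h2 : Module.finrank k S ≤ R' := by
      have := finrank_range_le_card (R := k) c'
      simpa [Set.finrank] using this
    have h3 := H φ (by omega)
    have := (cntIn_eq_iff c (LinearMap.ker φ)).1 (by omega) r
    exact hφ (by simpa using this)
  have hS2 : 2 ≤ Module.finrank k S := by
    have hli := hc ⟨0, by omega⟩ ⟨1, by omega⟩ (by simp)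
    have h1 := finrank_span_eq_card hli
    have h2 : Submodule.span k (Set.range ![c ⟨0, by omega⟩, c ⟨1, by omega⟩]) ≤ S := by
      rw [Submodule.span_le]
      rintro _ ⟨i, rfl⟩
      fin_cases i
      · exact hS _
      · exact hS _
    have := Submodule.finrank_mono h2
    simp only [Fintype.card_fin] at h1
    omega
  have main : ∀ q, cntIn c' (Submodule.span k {c' q}) + (R - R') ≤
      cntIn c (Submodule.span k {c' q}) := by
    intro q
    have hd : Module.finrank k (Submodule.span k {c' q}) = 1 := finrank_span_singleton (hc' q)
    apply perm_flat (R - R') (by omega) c c' H hS (Module.finrank k S - 2)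
    · apply le_antisymm
      · apply Submodule.span_mono
        rintro _ rfl
        exact ⟨q, Submodule.mem_span_singleton_self _, rfl⟩
      · rw [Submodule.span_le]
        rintro _ ⟨r, hr, rfl⟩
        exact hr
    · rw [hd]
      change 1 + (Module.finrank k S - 2) + 1 = Module.finrank k S
      omega
  have le1 : ∀ q, cntIn c (Submodule.span k {c' q}) ≤ 1 := by
    intro q
    unfold cntIn
    rw [Finset.card_le_one]
    intro r hr s hs
    by_contra hne
    simp only [Finset.mem_filter, Finset.mem_univ, true_and] at hr hs
    have h1 := finrank_span_eq_card (hc r s hne)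
    have h2 : Submodule.span k (Set.range ![c r, c s]) ≤ Submodule.span k {c' q} := by
      rw [Submodule.span_le]
      rintro _ ⟨i, rfl⟩
      fin_cases i
      · exact hr
      · exact hs
    have := Submodule.finrank_mono h2
    rw [finrank_span_singleton (hc' q), h1] at this
    simp at this
  have ge1 : ∀ q, 1 ≤ cntIn c' (Submodule.span k {c' q}) := by
    intro q
    unfold cntIn
    apply Finset.card_pos.2
    exact ⟨q, by simp [Submodule.mem_span_singleton_self]⟩
  have hne : Nonempty (Fin R') := by
    by_contra h
    rw [not_nonempty_iff] at h
    have : S = ⊥ := by rw [hSdef, Set.range_eq_empty, Submodule.span_empty]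
    rw [this] at hS2
    simp at hS2
  obtain ⟨q0⟩ := hne
  refine ⟨by have := main q0; have := le1 q0; have := ge1 q0; omega, ?_⟩
  have ex : ∀ q, ∃ r, c r ∈ Submodule.span k {c' q} := by
    intro q
    have h : 0 < cntIn c (Submodule.span k {c' q}) := by
      have := main q; have := ge1 q; omega
    obtain ⟨r, hr⟩ := Finset.card_pos.1 h
    exact ⟨r, by simpa using hr⟩
  choose σ hσ using ex
  have cne : ∀ r, c r ≠ 0 := by
    intro r
    have : ∃ s, r ≠ s := by
      have : Nontrivial (Fin R) := Fin.nontrivial_iff_two_le.2 hR2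
      obtain ⟨s, hs⟩ := exists_ne r
      exact ⟨s, hs.symm⟩
    obtain ⟨s, hs⟩ := this
    exact (hc r s hs).ne_zero 0
  have ex2 : ∀ q, ∃ l : k, l ≠ 0 ∧ c' q = l • c (σ q) := by
    intro q
    obtain ⟨a, ha⟩ := Submodule.mem_span_singleton.1 (hσ q)
    have ha0 : a ≠ 0 := by
      rintro rfl
      exact cne _ (by rw [← ha, zero_smul])
    exact ⟨a⁻¹, inv_ne_zero ha0, by rw [← ha, smul_smul, inv_mul_cancel₀ ha0, one_smul]⟩
  choose l hl using ex2
  refine ⟨σ, ?_, l, hl⟩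
  intro q s hqs
  have h1 : cntIn c' (Submodule.span k {c' q}) ≤ 1 := by
    have := main q; have := le1 q; omega
  unfold cntIn at h1
  rw [Finset.card_le_one] at h1
  apply h1 q (by simp [Submodule.mem_span_singleton_self]) s
  simp only [Finset.mem_filter, Finset.mem_univ, true_and]
  rw [(hl s).2, ← hqs]
  exact Submodule.smul_mem _ _ (hσ q)

end


section
variable {k : Type*} [Field k]

theorem dual_sum {K : ℕ} (φ : Module.Dual k (Fin K → k)) (v : Fin K → k) :
    φ v = ∑ i, v i * φ (Pi.single i 1) := by
  have := LinearMap.pi_apply_eq_sum_univ φ v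
  rw [this]
  refine Finset.sum_congr rfl fun i _ => ?_
  rw [smul_eq_mul]
  congr 2
  funext j
  simp [Pi.single_apply, eq_comm]

theorem dual_vec {V : Type*} [AddCommGroup V] [Module k V] {ι : Type*} {v : ι → V} {s : Set ι}
    (h : LinearIndepOn k v s) {r : ι} (hr : r ∈ s) :
    ∃ φ : Module.Dual k V, φ (v r) = 1 ∧ ∀ q ∈ s, q ≠ r → φ (v q) = 0 := by
  have h1 := h.notMem_span hr
  obtain ⟨φ, h2, h3⟩ := Submodule.exists_le_ker_of_notMem h1
  refine ⟨(φ (v r))⁻¹ • φ, by simp [h2], ?_⟩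
  intro q hq hne
  have : v q ∈ LinearMap.ker φ := h3 (Submodule.subset_span ⟨q, ⟨hq, hne⟩, rfl⟩)
  simp [LinearMap.mem_ker.1 this]

theorem mem_span_of_eq {I J R R' : ℕ} {A : Matrix (Fin I) (Fin R) k} {B : Matrix (Fin J) (Fin R) k}
    {A' : Matrix (Fin I) (Fin R') k} {B' : Matrix (Fin J) (Fin R') k}
    {d : Fin R → k} {d' : Fin R' → k}
    (hE : ∀ i j, ∑ r, A i r * B j r * d r = ∑ r, A' i r * B' j r * d' r)
    {s : Set (Fin R)} (hA : LinearIndepOn k A.transpose s) (hs : ∀ r, d r ≠ 0 → r ∈ s)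
    {s' : Set (Fin R')} (hs' : ∀ r, d' r ≠ 0 → r ∈ s')
    {r : Fin R} (hr : d r ≠ 0) :
    B.transpose r ∈ Submodule.span k (B'.transpose '' s') := by
  classical
  obtain ⟨φ, h1, h2⟩ := dual_vec hA (hs r hr)
  rw [dual_sum φ] at h1
  have h2' : ∀ q, q ≠ r → d q * ∑ i, A i q * φ (Pi.single i 1) = 0 := by
    intro q hq
    by_cases hd : d q = 0
    · simp [hd]
    · have := h2 q (hs q hd) hq
      rw [dual_sum φ] at this
      simp only [Matrix.transpose_apply] at this
      rw [this, mul_zero]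
  have e1 : ∀ j, B j r * d r = ∑ q, (d' q * ∑ i, A' i q * φ (Pi.single i 1)) * B' j q := by
    intro j
    have hL : ∑ i, (∑ q, A i q * B j q * d q) * φ (Pi.single i 1) =
        ∑ i, (∑ q, A' i q * B' j q * d' q) * φ (Pi.single i 1) := by
      simp_rw [hE]
    have e2 : ∑ i, (∑ q, A i q * B j q * d q) * φ (Pi.single i 1) =
        ∑ q, (d q * ∑ i, A i q * φ (Pi.single i 1)) * B j q := by
      simp_rw [Finset.sum_mul, Finset.mul_sum, Finset.sum_mul]
      rw [Finset.sum_comm]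
      refine Finset.sum_congr rfl fun q _ => Finset.sum_congr rfl fun i _ => by ring
    have e3 : ∑ i, (∑ q, A' i q * B' j q * d' q) * φ (Pi.single i 1) =
        ∑ q, (d' q * ∑ i, A' i q * φ (Pi.single i 1)) * B' j q := by
      simp_rw [Finset.sum_mul, Finset.mul_sum, Finset.sum_mul]
      rw [Finset.sum_comm]
      refine Finset.sum_congr rfl fun q _ => Finset.sum_congr rfl fun i _ => by ring
    rw [e2, e3] at hL
    rw [← hL, Finset.sum_eq_single r]
    · simp only [Matrix.transpose_apply] at h1
      rw [h1]; ring
    · intro q _ hq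
      rw [h2' q hq, zero_mul]
    · simp
  have e2 : B.transpose r = (d r)⁻¹ • ∑ q, (d' q * ∑ i, A' i q * φ (Pi.single i 1)) •
      B'.transpose q := by
    funext j
    simp only [Matrix.transpose_apply, Pi.smul_apply, Finset.sum_apply, smul_eq_mul]
    rw [← e1 j]
    field_simp
  rw [e2]
  apply Submodule.smul_mem
  apply Submodule.sum_mem
  intro q _
  by_cases hd : d' q = 0
  · simp [hd]
  · exact Submodule.smul_mem _ _ (Submodule.subset_span ⟨q, hs' q hd, rfl⟩)

theorem finrank_span_indepOn {V : Type*} [AddCommGroup V] [Module k V] {R : ℕ} {v : Fin R → V}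
    {s : Finset (Fin R)} (h : LinearIndepOn k v (s : Set (Fin R))) :
    Module.finrank k (Submodule.span k (v '' (s : Set (Fin R)))) = s.card := by
  have := finrank_span_eq_card (R := k) (b := fun x : (s : Set (Fin R)) => v x) h
  rw [Set.image_eq_range]
  simpa using this

theorem finrank_span_image_le {V : Type*} [AddCommGroup V] [Module k V] {R : ℕ} (v : Fin R → V)
    (s : Finset (Fin R)) :
    Module.finrank k (Submodule.span k (v '' (s : Set (Fin R)))) ≤ s.card := by
  classical
  have h2 := finrank_span_finset_le_card (R := k) (s.image v)
  rw [Set.finrank, Finset.coe_image] at h2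
  exact h2.trans Finset.card_image_le

/-- second part: uniqueness of the first two factors once the third is known -/
theorem two_factors {I J K R n : ℕ} (hn : n + 2 ≤ R)
    (A A' : Matrix (Fin I) (Fin R) k) (B B' : Matrix (Fin J) (Fin R) k)
    (C : Matrix (Fin K) (Fin R) k)
    (hE : ∀ i j l, ∑ r, A i r * B j r * C l r = ∑ r, A' i r * B' j r * C l r)
    (hA : ∀ s : Finset (Fin R), s.card ≤ n + 1 → LinearIndepOn k A.transpose (s : Set (Fin R)))
    (hB : ∀ s : Finset (Fin R), s.card ≤ n + 2 → LinearIndepOn k B.transpose (s : Set (Fin R)))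
    (hC : ∀ s : Finset (Fin R), s.card + n ≤ R → LinearIndepOn k C.transpose (s : Set (Fin R))) :
    ∀ r, ∃ la lb : k, la * lb = 1 ∧ (∀ i, A' i r = A i r * la) ∧ (∀ j, B' j r = B j r * lb) := by
  classical
  -- functionals
  have fn : ∀ Q : Finset (Fin R), Q.card = n + 1 → ∀ r ∈ Q, ∃ d : Fin R → k, d r = 1 ∧
      (∀ q, d q ≠ 0 → q ∈ Q) ∧
      ∀ i j, ∑ r, A i r * B j r * d r = ∑ r, A' i r * B' j r * d r := by
    intro Q hQ r hr
    have hcard : (insert r Qᶜ).card + n ≤ R := by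
      rw [Finset.card_insert_of_notMem (by simpa using hr), Finset.card_compl, hQ]
      simp only [Fintype.card_fin]
      omega
    obtain ⟨φ, h1, h2⟩ := dual_vec (hC _ hcard) (r := r) (by simp)
    refine ⟨fun q => φ (C.transpose q), h1, ?_, ?_⟩
    · intro q hq
      by_contra hqQ
      apply hq
      apply h2 q
      · simp [hqQ]
      · rintro rfl; exact hqQ hr
    · intro i j
      have e : ∀ (X : Matrix (Fin I) (Fin R) k) (Y : Matrix (Fin J) (Fin R) k),
          ∑ r, X i r * Y j r * φ (C.transpose r) =
          ∑ l, (∑ r, X i r * Y j r * C l r) * φ (Pi.single l 1) := by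
        intro X Y
        simp_rw [dual_sum φ (C.transpose _), Finset.sum_mul, Finset.mul_sum]
        rw [Finset.sum_comm]
        refine Finset.sum_congr rfl fun q _ => Finset.sum_congr rfl fun i _ => by
          simp only [Matrix.transpose_apply]; ring
      rw [e, e]
      simp_rw [hE]
  have sp : ∀ Q : Finset (Fin R), Q.card = n + 1 → ∀ r ∈ Q,
      B'.transpose r ∈ Submodule.span k (B.transpose '' (Q : Set (Fin R))) := by
    intro Q hQ r hr
    have hle : Submodule.span k (B.transpose '' (Q : Set (Fin R))) ≤
        Submodule.span k (B'.transpose '' (Q : Set (Fin R))) := by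
      rw [Submodule.span_le]
      rintro _ ⟨q, hq, rfl⟩
      obtain ⟨d, d1, d2, d3⟩ := fn Q hQ q hq
      exact mem_span_of_eq d3 (hA Q (by omega)) d2 d2 (by rw [d1]; exact one_ne_zero)
    have heq := Submodule.eq_of_le_of_finrank_le hle (by
      rw [finrank_span_indepOn (hB Q (by omega))]
      exact finrank_span_image_le _ _)
    rw [heq]
    exact Submodule.subset_span ⟨r, hr, rfl⟩
  have prop : ∀ r, ∃ l : k, B'.transpose r = l • B.transpose r := by
    intro r
    obtain ⟨P, hrP, hP⟩ := Finset.exists_superset_card_eq (s := {r}) (n := n + 2)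
      (by simp) (by simpa using hn)
    have hrP' : r ∈ P := hrP (by simp)
    have hmem : ∀ s ∈ P, s ≠ r → B'.transpose r ∈
        Submodule.span k (B.transpose '' ((P.erase s : Finset (Fin R)) : Set (Fin R))) := by
      intro s hs hne
      apply sp
      · rw [Finset.card_erase_of_mem hs]; omega
      · exact Finset.mem_erase.2 ⟨hne.symm, hrP'⟩
    have hmem2 : B'.transpose r ∈ Submodule.span k (B.transpose '' (P : Set (Fin R))) := by
      obtain ⟨s, hs, hne⟩ := Finset.exists_mem_ne (s := P) (by omega) r
      refine Submodule.span_mono ?_ (hmem s hs hne)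
      apply Set.image_mono
      exact_mod_cast Finset.erase_subset _ _
    obtain ⟨β, hβ⟩ : ∃ β : Fin R → k, ∑ i ∈ P, β i • B.transpose i = B'.transpose r := by
      obtain ⟨β0, hβ0⟩ := (Submodule.mem_span_image_finset_iff_exists_fun k).1 hmem2
      refine ⟨fun s => if h : s ∈ P then β0 ⟨s, h⟩ else 0, ?_⟩
      rw [← hβ0, ← Finset.sum_coe_sort]
      refine Finset.sum_congr rfl fun i _ => ?_
      simp
    have hz : ∀ s ∈ P, s ≠ r → β s = 0 := by
      intro s hs hne
      obtain ⟨φ, h1, h2⟩ := dual_vec (hB P (by omega)) (r := s) hs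
      have h3 : φ (B'.transpose r) = 0 := by
        have : Submodule.span k (B.transpose '' ((P.erase s : Finset (Fin R)) : Set (Fin R))) ≤
            LinearMap.ker φ := by
          rw [Submodule.span_le]
          rintro _ ⟨q, hq, rfl⟩
          have hq' := Finset.mem_erase.1 (Finset.mem_coe.1 hq)
          exact h2 q hq'.2 hq'.1
        exact this (hmem s hs hne)
      rw [← hβ, map_sum, Finset.sum_eq_single s] at h3
      · simpa [h1] using h3
      · intro q hq hqs
        rw [map_smul, h2 q hq hqs, smul_zero]
      · intro h; exact absurd hs h
    refine ⟨β r, ?_⟩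
    rw [← hβ, Finset.sum_eq_single r]
    · intro q hq hqr
      rw [hz q hq hqr, zero_smul]
    · intro h; exact absurd hrP' h
  choose l hl using prop
  have hl' : ∀ j r, B' j r = l r * B j r := fun j r => congrFun (hl r) j
  have hAl : ∀ r i, A i r = l r * A' i r := by
    intro r i
    obtain ⟨Q, hrQ, hQ⟩ := Finset.exists_superset_card_eq (s := {r}) (n := n + 1)
      (by simp) (by simp; omega)
    have hrQ' : r ∈ Q := hrQ (by simp)
    obtain ⟨d, d1, d2, d3⟩ := fn Q hQ r hrQ'
    obtain ⟨φ, h1, h2⟩ := dual_vec (hB Q (by omega)) (r := r) hrQ'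
    have e0 : ∑ q, ((A i q - l q * A' i q) * d q) • B.transpose q = 0 := by
      funext j
      simp only [Finset.sum_apply, Pi.smul_apply, Matrix.transpose_apply, smul_eq_mul,
        Pi.zero_apply]
      have := d3 i j
      rw [← sub_eq_zero, ← Finset.sum_sub_distrib] at this
      rw [← this]
      refine Finset.sum_congr rfl fun q _ => ?_
      rw [hl' j q]; ring
    have e1 := congrArg φ e0
    rw [map_sum, map_zero, Finset.sum_eq_single r] at e1
    · rw [map_smul, h1, d1] at e1
      simp only [mul_one, smul_eq_mul] at e1
      exact sub_eq_zero.1 e1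
    · intro q _ hqr
      by_cases hd : d q = 0
      · simp [hd]
      · rw [map_smul, h2 q (d2 q hd) hqr, smul_zero]
    · simp
  intro r
  have hlr : l r ≠ 0 := by
    intro h0
    have h1 := hA {r} (by simp)
    have : A.transpose r ≠ 0 := by
      have := h1.ne_zero (i := r) (by simp)
      exact this
    apply this
    funext i
    simp [hAl r i, h0]
  refine ⟨(l r)⁻¹, l r, inv_mul_cancel₀ hlr, ?_, ?_⟩
  · intro i; rw [hAl r i]; field_simp
  · intro j; rw [hl' j r, mul_comm]

end

theorem krank_spec {I R : ℕ} (A : Matrix (Fin I) (Fin R) F) :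
    krank A ≤ R ∧ ∀ s : Finset (Fin R), s.card ≤ krank A →
      LinearIndepOn F A.transpose (s : Set (Fin R)) := by
  have hmem := Nat.sSup_mem (s := {k | k ≤ R ∧ ∀ s : Finset (Fin R), s.card = k →
    LinearIndependent F (fun r : {x // x ∈ s} => A.transpose r.1)}) (by
      refine ⟨0, Nat.zero_le _, ?_⟩
      intro s hs
      have : s = ∅ := Finset.card_eq_zero.1 hs
      subst this
      exact linearIndependent_empty_type) ⟨R, fun k hk => hk.1⟩
  change krank A ≤ R ∧ ∀ s : Finset (Fin R), s.card = krank A →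
    LinearIndependent F (fun r : {x // x ∈ s} => A.transpose r.1) at hmem
  refine ⟨hmem.1, ?_⟩
  intro s hs
  obtain ⟨t, hst, ht⟩ := Finset.exists_superset_card_eq hs (by simpa using hmem.1)
  have h : LinearIndepOn F A.transpose (t : Set (Fin R)) := hmem.2 t ht
  exact h.mono (by exact_mod_cast hst)

theorem krank_le_rank {I R : ℕ} (A : Matrix (Fin I) (Fin R) F) : krank A ≤ A.rank := by
  obtain ⟨h1, h2⟩ := krank_spec A
  obtain ⟨s, -, hs⟩ := Finset.exists_superset_card_eq (s := (∅ : Finset (Fin R)))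
    (n := krank A) (by simp) (by simpa using h1)
  have := finrank_span_indepOn (h2 s hs.le)
  rw [Matrix.rank_eq_finrank_span_cols, ← hs, ← this]
  apply Submodule.finrank_mono
  apply Submodule.span_mono
  exact Set.image_subset_range _ _

theorem supp_card_add {K R : ℕ} (C : Matrix (Fin K) (Fin R) F)
    (φ : Module.Dual F (Fin K → F)) :
    (Finset.univ.filter fun r => φ (C.transpose r) ≠ 0).card +
      cntIn (C.transpose : Fin R → Fin K → F) (LinearMap.ker φ) = R := by
  classical
  have := cntIn_compl (C.transpose : Fin R → Fin K → F) (LinearMap.ker φ)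
  simp only [LinearMap.mem_ker] at this
  convert this using 3

theorem contract_eq {I J K R R' : ℕ}
    {A : Matrix (Fin I) (Fin R) F} {B : Matrix (Fin J) (Fin R) F} {C : Matrix (Fin K) (Fin R) F}
    {A' : Matrix (Fin I) (Fin R') F} {B' : Matrix (Fin J) (Fin R') F}
    {C' : Matrix (Fin K) (Fin R') F} (hT : pdTensor A B C = pdTensor A' B' C')
    (φ : Module.Dual F (Fin K → F)) (i : Fin I) (j : Fin J) :
    ∑ r, A i r * B j r * φ (C.transpose r) = ∑ r, A' i r * B' j r * φ (C'.transpose r) := by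
  have e : ∀ (N : ℕ) (X : Matrix (Fin I) (Fin N) F) (Y : Matrix (Fin J) (Fin N) F)
      (Z : Matrix (Fin K) (Fin N) F), ∑ r, X i r * Y j r * φ (Z.transpose r) =
      ∑ l, pdTensor X Y Z i j l * φ (Pi.single l 1) := by
    intro N X Y Z
    unfold pdTensor
    simp_rw [dual_sum φ (Z.transpose _), Finset.sum_mul, Finset.mul_sum]
    rw [Finset.sum_comm]
    refine Finset.sum_congr rfl fun q _ => Finset.sum_congr rfl fun i _ => by
      simp only [Matrix.transpose_apply]; ring
  rw [e, e, hT]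

theorem supp_lt_of_condU {I J R R' m : ℕ}
    {A : Matrix (Fin I) (Fin R) F} {B : Matrix (Fin J) (Fin R) F}
    {A' : Matrix (Fin I) (Fin R') F} {B' : Matrix (Fin J) (Fin R') F}
    {d : Fin R → F} {d' : Fin R' → F} (hU : CondU m A B)
    (hE : ∀ i j, ∑ r, A i r * B j r * d r = ∑ r, A' i r * B' j r * d' r)
    (hd' : (Finset.univ.filter fun r => d' r ≠ 0).card < m) :
    (Finset.univ.filter fun r => d r ≠ 0).card < m := by
  have h0 : hatVec m d = 0 := by
    apply hU
    funext p
    obtain ⟨s, u⟩ := p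
    have e1 := cauchyBinet_aux (fun (a : Fin m) r => A (s.1.orderIsoOfFin s.2 a).1 r)
      (fun (a : Fin m) r => B (u.1.orderIsoOfFin u.2 a).1 r) d
    have e2 := cauchyBinet_aux (fun (a : Fin m) r => A' (s.1.orderIsoOfFin s.2 a).1 r)
      (fun (a : Fin m) r => B' (u.1.orderIsoOfFin u.2 a).1 r) d'
    have e3 : (Matrix.of fun a b : Fin m => ∑ r, A (s.1.orderIsoOfFin s.2 a).1 r *
          B (u.1.orderIsoOfFin u.2 b).1 r * d r) =
        (Matrix.of fun a b : Fin m => ∑ r, A' (s.1.orderIsoOfFin s.2 a).1 r *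
          B' (u.1.orderIsoOfFin u.2 b).1 r * d' r) := by
      ext a b
      simp only [Matrix.of_apply]
      exact hE _ _
    rw [e3, e2] at e1
    change ∑ t : {t : Finset (Fin R) // t.card = m},
      compound m A s t * compound m B u t * hatVec m d t = 0
    refine Eq.trans ?_ (e1.symm.trans ?_)
    · rfl
    · apply Finset.sum_eq_zero
      intro t _
      have : ∃ i ∈ t.1, d' i = 0 := by
        by_contra! hcon
        have hsub : t.1 ⊆ Finset.univ.filter fun r => d' r ≠ 0 := by
          intro i hi
          simpa using hcon i hi
        have := Finset.card_le_card hsub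
        rw [t.2] at this
        omega
      obtain ⟨i, hi, hi0⟩ := this
      rw [Finset.prod_eq_zero hi hi0, mul_zero]
  by_contra! hcon
  obtain ⟨t, hts, ht⟩ := Finset.exists_subset_card_eq hcon
  have h1 := congrFun h0 ⟨t, ht⟩
  simp only [hatVec, Pi.zero_apply] at h1
  obtain ⟨i, hi, hi0⟩ := Finset.prod_eq_zero_iff.1 h1
  have := hts hi
  simp only [Finset.mem_filter, Finset.mem_univ, true_and] at this
  exact this hi0

theorem third_factor {I J K R R' : ℕ} (hR : R' ≤ R)
    (A : Matrix (Fin I) (Fin R) F) (B : Matrix (Fin J) (Fin R) F) (C : Matrix (Fin K) (Fin R) F)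
    (A' : Matrix (Fin I) (Fin R') F) (B' : Matrix (Fin J) (Fin R') F)
    (C' : Matrix (Fin K) (Fin R') F) (hT : pdTensor A B C = pdTensor A' B' C')
    (hC' : ∀ r, C'.transpose r ≠ 0)
    (hA : R + 1 ≤ krank A + C.rank) (hB : R + 1 ≤ krank B + C.rank) (hC : 2 ≤ krank C)
    (hU : CondU (R - C.rank + 2) A B) :
    R' = R ∧ ∃ σ : Fin R' → Fin R, Function.Injective σ ∧
      ∃ l : Fin R' → F, ∀ q, l q ≠ 0 ∧ C'.transpose q = l q • C.transpose (σ q) := by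
  classical
  have hRk := (krank_spec C).1
  have hrR : C.rank ≤ R := by simpa using Matrix.rank_le_width C
  have claim : ∀ φ : Module.Dual F (Fin K → F),
      (Finset.univ.filter fun r => φ (C'.transpose r) ≠ 0).card ≤ R - C.rank + 1 →
      (Finset.univ.filter fun r => φ (C.transpose r) ≠ 0).card ≤
        (Finset.univ.filter fun r => φ (C'.transpose r) ≠ 0).card := by
    intro φ hφ
    have hE := contract_eq hT φ
    have hlt := supp_lt_of_condU hU hE (by omega)
    set s := Finset.univ.filter fun r => φ (C.transpose r) ≠ 0 with hs
    set s' := Finset.univ.filter fun r => φ (C'.transpose r) ≠ 0 with hs'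
    have hAs := (krank_spec A).2 s (by omega)
    have hBs := (krank_spec B).2 s (by omega)
    rw [← finrank_span_indepOn hBs]
    refine le_trans ?_ (finrank_span_image_le (k := F) B'.transpose s')
    apply Submodule.finrank_mono
    rw [Submodule.span_le]
    rintro _ ⟨r, hr, rfl⟩
    refine mem_span_of_eq hE hAs ?_ ?_ (r := r) ?_
    · intro q hq; simpa [hs] using hq
    · intro q hq; simpa [hs'] using hq
    · simpa [hs] using hr
  have hspan : ∀ r, C.transpose r ∈ Submodule.span F (Set.range C'.transpose) := by
    intro r
    by_contra hr
    obtain ⟨φ, hφ, hφS⟩ := Submodule.exists_le_ker_of_notMem hr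
    have hz : (Finset.univ.filter fun r => φ (C'.transpose r) ≠ 0) = ∅ := by
      rw [Finset.filter_eq_empty_iff]
      intro q _
      rw [not_not]
      exact hφS (Submodule.subset_span ⟨q, rfl⟩)
    have h1 := claim φ (by rw [hz]; simp)
    rw [hz, Finset.card_empty, Nat.le_zero, Finset.card_eq_zero, Finset.filter_eq_empty_iff] at h1
    exact h1 (Finset.mem_univ r) hφ
  have hrank : C.rank ≤ Module.finrank F (Submodule.span F (Set.range C'.transpose)) := by
    rw [Matrix.rank_eq_finrank_span_cols]
    apply Submodule.finrank_mono
    rw [Submodule.span_le]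
    rintro _ ⟨r, rfl⟩
    exact hspan r
  refine perm_lemma hR (by omega) (C.transpose : Fin R → Fin K → F)
    (C'.transpose : Fin R' → Fin K → F) ?_ hC' ?_
  · intro r s hrs
    have h := (krank_spec C).2 {r, s} (by rw [Finset.card_pair hrs]; exact hC)
    have h2 : LinearIndependent F (fun x : (({r, s} : Finset (Fin R)) : Set (Fin R)) =>
      C.transpose x) := h
    have h3 := h2.comp (fun i : Fin 2 => (⟨![r, s] i, by fin_cases i <;> simp⟩ :
      (({r, s} : Finset (Fin R)) : Set (Fin R)))) (by
        intro a b hab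
        fin_cases a <;> fin_cases b <;> simp_all)
    refine Eq.mp ?_ h3
    congr 1
    funext i
    fin_cases i <;> rfl
  · intro φ hφ
    have h1 := supp_card_add C φ
    have h2 := supp_card_add C' φ
    have h3 := claim φ (by omega)
    omega

/-- Equivalence of two triples of factor matrices up to permutation and scaling. -/
def FacRel {I J K R : ℕ} (A A' : Matrix (Fin I) (Fin R) F) (B B' : Matrix (Fin J) (Fin R) F)
    (C C' : Matrix (Fin K) (Fin R) F) : Prop :=
  ∃ σ : Equiv.Perm (Fin R), ∃ la lb lc : Fin R → F,
      (∀ r, la r * lb r * lc r = 1) ∧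
      (∀ i r, A' i r = A i (σ r) * la r) ∧
      (∀ j r, B' j r = B j (σ r) * lb r) ∧
      (∀ k r, C' k r = C k (σ r) * lc r)

theorem facRel_trans {I J K R : ℕ} {A A1 A2 : Matrix (Fin I) (Fin R) F}
    {B B1 B2 : Matrix (Fin J) (Fin R) F} {C C1 C2 : Matrix (Fin K) (Fin R) F}
    (h1 : FacRel A A1 B B1 C C1) (h2 : FacRel A A2 B B2 C C2) : FacRel A1 A2 B1 B2 C1 C2 := by
  obtain ⟨σ, la, lb, lc, hp, hA, hB, hC⟩ := h1
  obtain ⟨τ, ma, mb, mc, hq, hA', hB', hC'⟩ := h2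
  have na : ∀ r, la r ≠ 0 := fun r h => by have := hp r; simp [h] at this
  have nb : ∀ r, lb r ≠ 0 := fun r h => by have := hp r; simp [h] at this
  have nc : ∀ r, lc r ≠ 0 := fun r h => by have := hp r; simp [h] at this
  refine ⟨τ.trans σ.symm, fun r => (la (σ.symm (τ r)))⁻¹ * ma r,
    fun r => (lb (σ.symm (τ r)))⁻¹ * mb r, fun r => (lc (σ.symm (τ r)))⁻¹ * mc r, ?_, ?_, ?_, ?_⟩
  · intro r
    have e1 := hp (σ.symm (τ r))
    have e2 := hq r
    calc _ = (la (σ.symm (τ r)) * lb (σ.symm (τ r)) * lc (σ.symm (τ r)))⁻¹ *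
          (ma r * mb r * mc r) := by rw [mul_inv, mul_inv]; ring
      _ = 1 := by rw [e1, e2]; simp
  · intro i r
    have := na (σ.symm (τ r))
    simp only [Equiv.trans_apply, hA', hA, Equiv.apply_symm_apply]
    field_simp
  · intro i r
    have := nb (σ.symm (τ r))
    simp only [Equiv.trans_apply, hB', hB, Equiv.apply_symm_apply]
    field_simp
  · intro i r
    have := nc (σ.symm (τ r))
    simp only [Equiv.trans_apply, hC', hC, Equiv.apply_symm_apply]
    field_simp

theorem core_unique {I J K R R' : ℕ} (hR : R' ≤ R)
    (A : Matrix (Fin I) (Fin R) F) (B : Matrix (Fin J) (Fin R) F) (C : Matrix (Fin K) (Fin R) F)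
    (A' : Matrix (Fin I) (Fin R') F) (B' : Matrix (Fin J) (Fin R') F)
    (C' : Matrix (Fin K) (Fin R') F) (hT : pdTensor A B C = pdTensor A' B' C')
    (hC' : ∀ r, C'.transpose r ≠ 0)
    (h1 : max (min (krank A) (krank B - 1)) (min (krank A - 1) (krank B)) + krank C ≥ R + 1)
    (h2 : CondU (R - C.rank + 2) A B) :
    ∃ h : R' = R, FacRel A (h ▸ A') B (h ▸ B') C (h ▸ C') := by
  have kA := krank_spec A
  have kB := krank_spec B
  have kC := krank_spec C
  have hrk := krank_le_rank C
  obtain ⟨rfl, σ, hσ, l, hl⟩ := third_factor hR A B C A' B' C' hT hC' (by omega) (by omega)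
    (by omega) h2
  refine ⟨rfl, ?_⟩
  obtain ⟨τ, rfl⟩ : ∃ τ : Equiv.Perm (Fin R'), σ = τ :=
    ⟨Equiv.ofBijective σ (Finite.injective_iff_bijective.1 hσ), rfl⟩
  have hCC : ∀ c q, C' c q = l q * C c (τ q) := fun c q => congrFun (hl q).2 c
  have hE : ∀ i j c, ∑ r, A i r * B j r * C c r =
      ∑ r, A' i (τ.symm r) * (B' j (τ.symm r) * l (τ.symm r)) * C c r := by
    intro i j c
    have := congrFun (congrFun (congrFun hT i) j) c
    unfold pdTensor at this
    rw [this, ← Equiv.sum_comp τ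
      (fun r => A' i (τ.symm r) * (B' j (τ.symm r) * l (τ.symm r)) * C c r)]
    refine Finset.sum_congr rfl fun q _ => ?_
    simp only [hCC, Equiv.symm_apply_apply]
    ring
  have key : ∀ r, ∃ la lb : F, la * lb = 1 ∧ (∀ i, A' i (τ.symm r) = A i r * la) ∧
      (∀ j, B' j (τ.symm r) * l (τ.symm r) = B j r * lb) := by
    rcases le_total (min (krank A - 1) (krank B)) (min (krank A) (krank B - 1)) with h | h
    · rw [max_eq_left h] at h1
      exact two_factors (n := R' - krank C) (by omega) A (fun i r => A' i (τ.symm r)) B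
        (fun j r => B' j (τ.symm r) * l (τ.symm r)) C hE
        (fun s hs => kA.2 s (by omega)) (fun s hs => kB.2 s (by omega))
        (fun s hs => kC.2 s (by omega))
    · rw [max_eq_right h] at h1
      have := two_factors (n := R' - krank C) (by omega) B
        (fun j r => B' j (τ.symm r) * l (τ.symm r)) A (fun i r => A' i (τ.symm r)) C
        (fun j i c => by
          have := hE i j c
          simp only [mul_comm (A _ _), mul_comm (A' _ _)] at this
          exact this)
        (fun s hs => kB.2 s (by omega)) (fun s hs => kA.2 s (by omega))
        (fun s hs => kC.2 s (by omega))
      intro r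
      obtain ⟨la, lb, e1, e2, e3⟩ := this r
      exact ⟨lb, la, by rw [mul_comm, e1], e3, e2⟩
  choose la lb hab hAA hBB using key
  refine ⟨τ, fun r => la (τ r), fun r => lb (τ r) * (l r)⁻¹, l, ?_, ?_, ?_, ?_⟩
  · intro r
    have := (hl r).1
    have := hab (τ r)
    field_simp
    exact this
  · intro i r
    have := hAA (τ r) i
    rwa [Equiv.symm_apply_apply] at this
  · intro j r
    have h0 := (hl r).1
    have := hBB (τ r) j
    rw [Equiv.symm_apply_apply] at this
    rw [← mul_assoc, ← this]
    field_simp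
  · intro c r
    exact (hCC c r).trans (mul_comm _ _)

/-- Corollary 1.14: uniqueness of the CPD under (5.1) and (U m_C). -/
theorem stmt_3 {I J K R : ℕ} (T : Fin I → Fin J → Fin K → F)
    (A : Matrix (Fin I) (Fin R) F) (B : Matrix (Fin J) (Fin R) F) (C : Matrix (Fin K) (Fin R) F)
    (hPD : IsPD T A B C)
    (h1 : max (min (krank A) (krank B - 1)) (min (krank A - 1) (krank B)) + krank C ≥ R + 1)
    (h2 : CondU (R - C.rank + 2) A B) :
    tensorRank T = R ∧ CPDUnique T R := by
  obtain ⟨hA0, hB0, hC0, hT0⟩ := hPD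
  constructor
  · apply le_antisymm
    · exact Nat.sInf_le ⟨A, B, C, hA0, hB0, hC0, hT0⟩
    · unfold tensorRank
      refine le_csInf ⟨R, A, B, C, hA0, hB0, hC0, hT0⟩ ?_
      rintro R' ⟨A', B', C', -, -, hC', hT'⟩
      by_contra! hlt
      obtain ⟨h, -⟩ := core_unique hlt.le A B C A' B' C' (hT0.symm.trans hT') hC' h1 h2
      omega
  · intro A1 A2 B1 B2 C1 C2 hP1 hP2
    obtain ⟨-, -, hC1, hT1⟩ := hP1
    obtain ⟨-, -, hC2, hT2⟩ := hP2
    obtain ⟨_, r1⟩ := core_unique le_rfl A B C A1 B1 C1 (hT0.symm.trans hT1) hC1 h1 h2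
    obtain ⟨_, r2⟩ := core_unique le_rfl A B C A2 B2 C2 (hT0.symm.trans hT2) hC2 h1 h2
    exact facRel_trans r1 r2
end

section
/- Let T = [A,B,C]_R with A ∈ F^{I×R}, B ∈ F^{J×R}, C ∈ F^{K×R}, and set m_C := R − r_C + 2. Assume: (i) max(min(k_A, k_B − 1), min(k_A − 1, k_B)) + k_C ≥ R + 1; (ii) condition (H m_C) holds for the pair (A,B). Then r_T = R and the CPD of T is unique. -/
open scoped Matrix
open MeasureTheory

variable {F : Type*} [RCLike F]

section Aux

open Module

theorem aux_sylvester {α β γ : Type*} [Fintype α] [Fintype β] [Fintype γ]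
    (M : Matrix α β F) (N : Matrix β γ F) :
    M.rank + N.rank ≤ Fintype.card β + (M * N).rank := by
  classical
  have h1 := LinearMap.finrank_range_add_finrank_ker M.mulVecLin
  have h2 := LinearMap.finrank_range_add_finrank_ker
    (M.mulVecLin.domRestrict (LinearMap.range N.mulVecLin))
  have h3 : LinearMap.range (M.mulVecLin.domRestrict (LinearMap.range N.mulVecLin)) =
      LinearMap.range (M * N).mulVecLin := by
    rw [Matrix.mulVecLin_mul, LinearMap.range_domRestrict, LinearMap.range_comp]
  have h4 : finrank F (LinearMap.ker (M.mulVecLin.domRestrict (LinearMap.range N.mulVecLin))) ≤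
      finrank F (LinearMap.ker M.mulVecLin) := by
    refine LinearMap.finrank_le_finrank_of_injective
      (f := ((LinearMap.range N.mulVecLin).subtype.comp
        (LinearMap.ker (M.mulVecLin.domRestrict (LinearMap.range N.mulVecLin))).subtype).codRestrict
          (LinearMap.ker M.mulVecLin) ?_) ?_
    · rintro ⟨⟨x, hx⟩, hx2⟩
      simpa using hx2
    · rintro ⟨⟨x, hx⟩, hx2⟩ ⟨⟨y, hy⟩, hy2⟩ h
      have h' := congrArg Subtype.val h
      apply Subtype.ext
      apply Subtype.ext
      exact h'
  rw [h3] at h2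
  simp only [finrank_fintype_fun_eq_card] at h1
  unfold Matrix.rank
  omega

theorem aux_perm_count {V : Type*} [AddCommGroup V] [Module F V] [FiniteDimensional F V] {R : ℕ}
    (c c' : Fin R → V)
    (hmem : ∀ r, c r ∈ Submodule.span F (Set.range c'))
    (H : ∀ φ : Module.Dual F V, (∀ [DecidableEq F],
      (Finset.univ.filter fun r => φ (c' r) ≠ 0).card +
        finrank F (Submodule.span F (Set.range c')) ≤ R + 1 →
      (Finset.univ.filter fun r => φ (c r) ≠ 0).card ≤
        (Finset.univ.filter fun r => φ (c' r) ≠ 0).card)) :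
    ∀ n : ℕ, ∀ W : Submodule F V, W = Submodule.span F (Set.image c' {r | c' r ∈ W}) →
      finrank F W + n = finrank F (Submodule.span F (Set.range c')) → ∀ [DecidablePred (· ∈ W)],
      (Finset.univ.filter fun r => c' r ∈ W).card ≤ (Finset.univ.filter fun r => c r ∈ W).card := by
  classical
  set S := Submodule.span F (Set.range c') with hS
  have hc'S : ∀ r, c' r ∈ S := fun r => Submodule.subset_span ⟨r, rfl⟩
  intro n
  induction n with
  | zero =>
    intro W hW hn _
    have hWS : W ≤ S := by
      rw [hW]; exact Submodule.span_mono (Set.image_subset_range _ _)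
    have : W = S := Submodule.eq_of_le_of_finrank_eq hWS (by simpa using hn)
    subst this
    simp [hmem, hc'S]
  | succ n ih =>
    intro W hW hn _
    have hWS : W ≤ S := by
      rw [hW]; exact Submodule.span_mono (Set.image_subset_range _ _)
    rcases Nat.eq_zero_or_pos n with h0 | hpos
    · subst h0
      have hlt : W < S := lt_of_le_of_ne hWS (by rintro rfl; omega)
      obtain ⟨v, hvS, hvW⟩ := SetLike.exists_of_lt hlt
      obtain ⟨φ, hφv, hφ⟩ := Submodule.exists_le_ker_of_notMem hvW
      have hker : LinearMap.ker φ ⊓ S = W := by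
        symm
        apply Submodule.eq_of_le_of_finrank_le (le_inf hφ hWS)
        have : LinearMap.ker φ ⊓ S < S := by
          refine lt_of_le_of_ne inf_le_right fun h => hφv ?_
          exact (h.ge hvS).1
        have := Submodule.finrank_lt_finrank_of_lt this
        omega
      have e1 : ∀ x ∈ S, (φ x ≠ 0 ↔ ¬ x ∈ W) := by
        intro x hx
        rw [← hker]; simp [hx]
      have key := H φ
      simp only [e1 _ (hc'S _), e1 _ (hmem _)] at key
      have a1 := Finset.card_filter_add_card_filter_not (s := (Finset.univ : Finset (Fin R)))
        (fun r => c' r ∈ W)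
      have a2 := Finset.card_filter_add_card_filter_not (s := (Finset.univ : Finset (Fin R)))
        (fun r => c r ∈ W)
      simp only [Finset.card_univ, Fintype.card_fin] at a1 a2
      have a3 : finrank F W ≤ (Finset.univ.filter fun r => c' r ∈ W).card := by
        have : W = Submodule.span F
            ((Finset.image c' (Finset.univ.filter fun r => c' r ∈ W) : Finset V) : Set V) := by
          conv_lhs => rw [hW]
          congr 1
          ext; simp
        have h5 := finrank_span_finset_le_card (R := F)
          (Finset.image c' (Finset.univ.filter fun r => c' r ∈ W))
        rw [Set.finrank, ← this] at h5
        exact h5.trans Finset.card_image_le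
      have := key (by omega)
      omega
    · set f : Fin R → Submodule F V := fun r => Submodule.span F {c' r} ⊔ W with hf
      set g : Fin R → Submodule F V := fun r => Submodule.span F {c r} ⊔ W with hg
      set P := Finset.univ.filter fun r => ¬ c' r ∈ W with hP
      set Q := Finset.univ.filter fun r => ¬ c r ∈ W with hQ
      set 𝓜 := P.image f with hM
      have cov : ∀ M ∈ 𝓜, W ⋖ M := by
        intro M hM'
        simp only [hM, hP, hf, Finset.mem_image, Finset.mem_filter, Finset.mem_univ,
          true_and] at hM'
        obtain ⟨r, hr, rfl⟩ := hM'
        exact Submodule.covBy_span_singleton_sup hr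
      have cov' : ∀ M ∈ 𝓜, ∀ x, x ∉ W → (x ∈ M ↔ Submodule.span F {x} ⊔ W = M) := by
        intro M hM' x hx
        constructor
        · intro hxM
          have hlt : W < Submodule.span F {x} ⊔ W := (Submodule.covBy_span_singleton_sup hx).lt
          have hle : Submodule.span F {x} ⊔ W ≤ M :=
            sup_le (by simpa using hxM) (cov M hM').le
          rcases hle.lt_or_eq with h | h
          · exact absurd h ((cov M hM').2 hlt)
          · exact h
        · rintro rfl
          exact Submodule.mem_sup_left (Submodule.mem_span_singleton_self x)
      have cW : ∀ (d : Fin R → V) (M) (_ : M ∈ 𝓜), (Finset.univ.filter fun r => d r ∈ M).card =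
          (Finset.univ.filter fun r => d r ∈ W).card +
          ((Finset.univ.filter fun r => ¬ d r ∈ W).filter
            fun r => Submodule.span F {d r} ⊔ W = M).card := by
        intro d M hM'
        rw [← Finset.card_filter_add_card_filter_not (s := Finset.univ.filter fun r => d r ∈ M)
          (fun r => d r ∈ W)]
        congr 2
        · ext r
          simp only [Finset.mem_filter, Finset.mem_univ, true_and]
          exact ⟨fun h => h.2, fun h => ⟨(cov M hM').le h, h⟩⟩
        · ext r
          simp only [Finset.mem_filter, Finset.mem_univ, true_and]
          constructor
          · rintro ⟨h, h'⟩; exact ⟨h', (cov' M hM' _ h').1 h⟩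
          · rintro ⟨h', h⟩; exact ⟨(cov' M hM' _ h').2 h, h'⟩
      have s1 : P.card = ∑ M ∈ 𝓜, (P.filter fun r => f r = M).card :=
        Finset.card_eq_sum_card_fiberwise fun r hr => Finset.mem_coe.2 (Finset.mem_image_of_mem f hr)
      have s2 : ∑ M ∈ 𝓜, (Q.filter fun r => g r = M).card ≤ Q.card := by
        rw [← Finset.card_biUnion]
        · apply Finset.card_le_card
          intro r
          simp only [Finset.mem_biUnion, Finset.mem_filter]
          rintro ⟨M, _, h, _⟩; exact h
        · intro M _ M' _ hne
          rw [Function.onFun, Finset.disjoint_left]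
          intro r hr hr'
          exact hne ((Finset.mem_filter.1 hr).2.symm.trans (Finset.mem_filter.1 hr').2)
      have a1 := Finset.card_filter_add_card_filter_not (s := (Finset.univ : Finset (Fin R)))
        (fun r => c' r ∈ W)
      have a2 := Finset.card_filter_add_card_filter_not (s := (Finset.univ : Finset (Fin R)))
        (fun r => c r ∈ W)
      simp only [Finset.card_univ, Fintype.card_fin] at a1 a2
      have frM : ∀ M ∈ 𝓜, finrank F M = finrank F W + 1 := by
        intro M hM'
        simp only [hM, hP, hf, Finset.mem_image, Finset.mem_filter, Finset.mem_univ,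
          true_and] at hM'
        obtain ⟨r, hr, rfl⟩ := hM'
        have h1 := Submodule.finrank_lt_finrank_of_lt (Submodule.covBy_span_singleton_sup (K := F) hr).lt
        have h2 := Submodule.finrank_add_le_finrank_add_finrank (Submodule.span F {c' r}) W
        have h3 := finrank_span_le_card (R := F) ({c' r} : Set V)
        simp at h3
        omega
      have hIH : ∀ M ∈ 𝓜, (Finset.univ.filter fun r => c' r ∈ M).card ≤
          (Finset.univ.filter fun r => c r ∈ M).card := by
        intro M hM'
        have hfr := frM M hM'
        refine ih M ?_ (by omega)
        apply le_antisymm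
        · simp only [hM, hP, hf, Finset.mem_image, Finset.mem_filter, Finset.mem_univ,
            true_and] at hM'
          obtain ⟨r, hr, rfl⟩ := hM'
          apply sup_le
          · rw [Submodule.span_singleton_le_iff_mem]
            exact Submodule.subset_span ⟨r, Submodule.mem_sup_left
              (Submodule.mem_span_singleton_self _), rfl⟩
          · conv_lhs => rw [hW]
            apply Submodule.span_mono
            apply Set.image_mono
            intro s hs
            exact Submodule.mem_sup_right hs
        · rw [Submodule.span_le]
          rintro _ ⟨s, hs, rfl⟩
          exact hs
      have hsum : ∑ M ∈ 𝓜, ((Finset.univ.filter fun r => c' r ∈ W).card +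
            (P.filter fun r => f r = M).card) ≤
          ∑ M ∈ 𝓜, ((Finset.univ.filter fun r => c r ∈ W).card +
            (Q.filter fun r => g r = M).card) := by
        apply Finset.sum_le_sum
        intro M hM'
        have := hIH M hM'
        rw [cW c' M hM', cW c M hM'] at this
        exact this
      rw [Finset.sum_add_distrib, Finset.sum_add_distrib, ← s1, Finset.sum_const,
        Finset.sum_const, smul_eq_mul, smul_eq_mul] at hsum
      have hcard : 2 ≤ 𝓜.card := by
        by_contra hlt
        have hle : 𝓜.card ≤ 1 := by omega
        have hlt : W < S := lt_of_le_of_ne hWS (by rintro rfl; omega)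
        have : ∃ r, c' r ∉ W := by
          by_contra hcon
          push Not at hcon
          exact hlt.not_ge (Submodule.span_le.2 (by rintro _ ⟨r, rfl⟩; exact hcon r))
        obtain ⟨r, hr⟩ := this
        have hrM : f r ∈ 𝓜 := Finset.mem_image_of_mem f (by simp [hP, hr])
        have hSM : S ≤ f r := by
          rw [hS, Submodule.span_le]
          rintro _ ⟨s, rfl⟩
          by_cases hs : c' s ∈ W
          · exact Submodule.mem_sup_right hs
          · have hsM : f s ∈ 𝓜 := Finset.mem_image_of_mem f (by simp [hP, hs])
            rw [Finset.card_le_one.1 hle _ hrM _ hsM]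
            exact Submodule.mem_sup_left (Submodule.mem_span_singleton_self _)
        have h1 := Submodule.finrank_mono hSM
        have h2 := frM _ hrM
        omega
      obtain ⟨q, hq⟩ : ∃ q, 𝓜.card = q + 2 := ⟨𝓜.card - 2, by omega⟩
      rw [hq] at hsum
      by_contra hcon
      push Not at hcon
      nlinarith

theorem aux_perm {V : Type*} [AddCommGroup V] [Module F V] [FiniteDimensional F V] {R : ℕ}
    (c c' : Fin R → V) (hc0 : ∀ r, c r ≠ 0)
    (hc : ∀ r s, r ≠ s → c r ∉ Submodule.span F {c s})
    (H : ∀ φ : Module.Dual F V, (∀ [DecidableEq F],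
      (Finset.univ.filter fun r => φ (c' r) ≠ 0).card +
        finrank F (Submodule.span F (Set.range c')) ≤ R + 1 →
      (Finset.univ.filter fun r => φ (c r) ≠ 0).card ≤
        (Finset.univ.filter fun r => φ (c' r) ≠ 0).card)) :
    ∃ σ : Equiv.Perm (Fin R), ∃ l : Fin R → F, (∀ r, l r ≠ 0) ∧ ∀ r, c' r = l r • c (σ r) := by
  classical
  have hfr : finrank F (Submodule.span F (Set.range c')) ≤ R := by
    simpa [Set.finrank] using finrank_range_le_card (R := F) c'
  have hmem : ∀ r, c r ∈ Submodule.span F (Set.range c') := by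
    intro r
    by_contra hr
    obtain ⟨φ, hφv, hφ⟩ := Submodule.exists_le_ker_of_notMem hr
    have h0 : ∀ s, φ (c' s) = 0 := fun s => hφ (Submodule.subset_span ⟨s, rfl⟩)
    have := H φ
    simp only [h0] at this
    have := this (by simp; omega)
    simp only [ne_eq, not_true_eq_false, Finset.filter_false, Finset.card_empty,
      Nat.le_zero, Finset.card_eq_zero] at this
    have hm : r ∈ (Finset.univ.filter fun r => ¬ φ (c r) = 0) := by simp [hφv]
    rw [this] at hm
    simp at hm
  have main := aux_perm_count c c' hmem H
  have main' : ∀ W : Submodule F V, W = Submodule.span F (Set.image c' {r | c' r ∈ W}) → 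
      (Finset.univ.filter fun r => c' r ∈ W).card ≤
        (Finset.univ.filter fun r => c r ∈ W).card := by
    intro W hW
    have hWS : W ≤ Submodule.span F (Set.range c') := by
      rw [hW]; exact Submodule.span_mono (Set.image_subset_range _ _)
    have := Submodule.finrank_mono hWS
    exact main (finrank F (Submodule.span F (Set.range c')) - finrank F W) W hW (by omega)
  have hc'0 : ∀ r, c' r ≠ 0 := by
    intro r hr
    have := main' ⊥ (by
      symm
      rw [Submodule.span_eq_bot]
      rintro _ ⟨s, hs, rfl⟩
      simpa using hs)
    simp only [Submodule.mem_bot, hc0, Finset.filter_false, Finset.card_empty, Nat.le_zero,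
      Finset.card_eq_zero] at this
    have hm : r ∈ (Finset.univ.filter fun r => c' r = 0) := by simp [hr]
    rw [this] at hm
    simp at hm
  have line : ∀ r, (Finset.univ.filter fun s => c' s ∈ Submodule.span F {c' r}).card ≤
      (Finset.univ.filter fun s => c s ∈ Submodule.span F {c' r}).card := by
    intro r
    apply main'
    apply le_antisymm
    · rw [Submodule.span_singleton_le_iff_mem]
      exact Submodule.subset_span ⟨r, Submodule.mem_span_singleton_self _, rfl⟩
    · rw [Submodule.span_le]
      rintro _ ⟨s, hs, rfl⟩
      exact hs
  have ex : ∀ r, ∃ s, c s ∈ Submodule.span F {c' r} := by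
    intro r
    have h1 : 0 < (Finset.univ.filter fun s => c' s ∈ Submodule.span F {c' r}).card :=
      Finset.card_pos.2 ⟨r, by simp⟩
    obtain ⟨s, hs⟩ := Finset.card_pos.1 (h1.trans_le (line r))
    exact ⟨s, (Finset.mem_filter.1 hs).2⟩
  choose σ hσ using ex
  have ex2 : ∀ r, ∃ l : F, l ≠ 0 ∧ c' r = l • c (σ r) := by
    intro r
    obtain ⟨k, hk⟩ := Submodule.mem_span_singleton.1 (hσ r)
    have hk0 : k ≠ 0 := by
      rintro rfl
      exact hc0 (σ r) (by simpa using hk.symm)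
    exact ⟨k⁻¹, inv_ne_zero hk0, by rw [← hk, smul_smul, inv_mul_cancel₀ hk0, one_smul]⟩
  choose l hl0 hl using ex2
  have spaneq : ∀ r, Submodule.span F {c' r} = Submodule.span F {c (σ r)} := by
    intro r
    rw [hl r]
    exact Submodule.span_singleton_smul_eq (IsUnit.mk0 _ (hl0 r)) _
  have inj : Function.Injective σ := by
    intro r s hrs
    by_contra hne
    have h2 : 1 < (Finset.univ.filter fun t => c' t ∈ Submodule.span F {c' r}).card := by
      rw [Finset.one_lt_card]
      refine ⟨r, by simp, s, ?_, hne⟩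
      simp only [Finset.mem_filter, Finset.mem_univ, true_and]
      rw [spaneq r, hrs, ← spaneq s]
      exact Submodule.mem_span_singleton_self _
    have h3 := h2.trans_le (line r)
    rw [Finset.one_lt_card] at h3
    obtain ⟨p, hp, q, hq, hpq⟩ := h3
    simp only [Finset.mem_filter, Finset.mem_univ, true_and, spaneq r] at hp hq
    have hp' : p = σ r := by
      by_contra h; exact hc _ _ h hp
    have hq' : q = σ r := by
      by_contra h; exact hc _ _ h hq
    exact hpq (hp'.trans hq'.symm)
  exact ⟨Equiv.ofBijective σ (Finite.injective_iff_bijective.1 inj), l, hl0, hl⟩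

theorem aux_pick {V : Type*} [AddCommGroup V] [Module F V] {R : ℕ} (v : Fin R → V)
    (s : Finset (Fin R)) (h : LinearIndependent F (fun r : {x // x ∈ s} => v r.1))
    (i : Fin R) (hi : i ∈ s) :
    ∃ φ : Module.Dual F V, φ (v i) = 1 ∧ ∀ j ∈ s, j ≠ i → φ (v j) = 0 := by
  classical
  have hn : v i ∉ Submodule.span F
      (Set.image (fun r : {x // x ∈ s} => v r.1) (Set.univ \ {⟨i, hi⟩})) := by
    have := (linearIndependent_iff_notMem_span.1 h) ⟨i, hi⟩
    exact this
  obtain ⟨φ, h1, h2⟩ := Submodule.exists_le_ker_of_notMem hn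
  refine ⟨(φ (v i))⁻¹ • φ, by simp [h1], ?_⟩
  intro j hj hji
  have : φ (v j) = 0 := h2 (Submodule.subset_span ⟨⟨j, hj⟩, by simpa using hji, rfl⟩)
  simp [this]

theorem aux_dual_ext {V : Type*} [AddCommGroup V] [Module F V] {v w : V}
    (h : ∀ φ : Module.Dual F V, φ v = φ w) : v = w := by
  rw [← sub_eq_zero, ← Module.forall_dual_apply_eq_zero_iff F]
  intro φ
  rw [map_sub, h, sub_self]

theorem aux_step2 {VA VB VC : Type*} [AddCommGroup VA] [Module F VA] [AddCommGroup VB]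
    [Module F VB] [AddCommGroup VC] [Module F VC] [FiniteDimensional F VB]
    {R t k : ℕ} (a a' : Fin R → VA) (b b' : Fin R → VB) (c : Fin R → VC)
    (htk : t + k = R + 1) (hk : 2 ≤ k) (hkR : k ≤ R)
    (hb'0 : ∀ r, b' r ≠ 0)
    (ha : ∀ s : Finset (Fin R), s.card ≤ t → LinearIndependent F (fun r : {x // x ∈ s} => a r.1))
    (hb : ∀ s : Finset (Fin R), s.card ≤ t + 1 →
      LinearIndependent F (fun r : {x // x ∈ s} => b r.1))
    (hc : ∀ s : Finset (Fin R), s.card ≤ k → LinearIndependent F (fun r : {x // x ∈ s} => c r.1))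
    (h : ∀ (φ : Module.Dual F VA) (ψ : Module.Dual F VB) (χ : Module.Dual F VC),
      ∑ r, φ (a r) * ψ (b r) * χ (c r) = ∑ r, φ (a' r) * ψ (b' r) * χ (c r)) :
    ∃ β : Fin R → F, ∀ r, β r ≠ 0 ∧ b' r = β r • b r ∧ a r = β r • a' r := by
  classical
  have pickc : ∀ (T : Finset (Fin R)) (i : Fin R), T.card = t → i ∈ T →
      ∃ χ : Module.Dual F VC, χ (c i) = 1 ∧ ∀ j, j ∉ T → χ (c j) = 0 := by
    intro T i hT hi
    have hcard : (insert i Tᶜ).card ≤ k := by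
      refine (Finset.card_insert_le _ _).trans ?_
      rw [Finset.card_compl, hT, Fintype.card_fin]; omega
    obtain ⟨χ, h1, h2⟩ := aux_pick c _ (hc _ hcard) i (by simp)
    refine ⟨χ, h1, fun j hj => h2 j (by simp [hj]) ?_⟩
    rintro rfl; exact hj hi
  have hspan : ∀ (T : Finset (Fin R)), T.card = t →
      Submodule.span F (Set.image b T) = Submodule.span F (Set.image b' T) := by
    intro T hT
    apply Submodule.eq_of_le_of_finrank_le
    · rw [Submodule.span_le]
      rintro _ ⟨i, hi, rfl⟩
      obtain ⟨χ, hχ1, hχ2⟩ := pickc T i hT hi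
      obtain ⟨φ, hφ1, hφ2⟩ := aux_pick a T (ha T hT.le) i hi
      have : b i = ∑ j ∈ T, (φ (a' j) * χ (c j)) • b' j := by
        apply aux_dual_ext (F := F)
        intro ψ
        have e := h φ ψ χ
        rw [Finset.sum_eq_single i] at e
        · rw [hφ1, hχ1, one_mul, mul_one] at e
          rw [e, map_sum]
          rw [← Finset.sum_subset (Finset.subset_univ T)]
          · apply Finset.sum_congr rfl
            intro j _
            rw [map_smul, smul_eq_mul]; ring
          · intro j _ hj
            rw [hχ2 j hj, mul_zero]
        · intro j _ hji
          by_cases hj : j ∈ T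
          · rw [hφ2 j hj hji]; ring
          · rw [hχ2 j hj, mul_zero]
        · simp
      rw [SetLike.mem_coe, this]
      exact Submodule.sum_mem _ fun j hj => Submodule.smul_mem _ _
        (Submodule.subset_span ⟨j, hj, rfl⟩)
    · have h1 : finrank F (Submodule.span F (Set.image b' (T : Set (Fin R)))) ≤ t := by
        have := finrank_span_finset_le_card (R := F) (T.image b')
        rw [Set.finrank, Finset.coe_image] at this
        exact this.trans (Finset.card_image_le.trans hT.le)
      have h2 := finrank_span_eq_card (R := F) (hb T (by omega))
      have h3 : Set.range (fun r : {x // x ∈ T} => b r.1) = Set.image b (T : Set (Fin R)) := by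
        ext; simp
      rw [h3, Fintype.card_coe, hT] at h2
      omega
  have hT : ∀ r : Fin R, ∃ T : Finset (Fin R), r ∈ T ∧ T.card = t := by
    intro r
    obtain ⟨T, h1, h2, h3⟩ := Finset.exists_subsuperset_card_eq
      (Finset.subset_univ ({r} : Finset (Fin R))) (n := t) (by simp; omega) (by simp; omega)
    exact ⟨T, h1 (by simp), h3⟩
  have hβ : ∀ r, ∃ β : F, b' r = β • b r := by
    intro r
    obtain ⟨T, hrT, hTc⟩ := hT r
    have hm : ∀ T : Finset (Fin R), r ∈ T → T.card = t → b' r ∈ Submodule.span F (Set.image b T) := by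
      intro T hrT hTc
      rw [hspan T hTc]
      exact Submodule.subset_span ⟨r, hrT, rfl⟩
    obtain ⟨β, hβ⟩ := Submodule.mem_span_image_finset_iff_exists_fun' F |>.1 (hm T hrT hTc)
    refine ⟨β r, ?_⟩
    rw [← hβ, Finset.sum_eq_single_of_mem r hrT]
    intro i hi hir
    suffices β i = 0 by rw [this, zero_smul]
    obtain ⟨j, hj⟩ : ∃ j, j ∉ T := by
      by_contra hcon
      push Not at hcon
      have : T = Finset.univ := Finset.eq_univ_iff_forall.2 hcon
      rw [this, Finset.card_univ, Fintype.card_fin] at hTc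
      omega
    have hij : i ≠ j := by rintro rfl; exact hj hi
    obtain ⟨ψ, h1, h2⟩ := aux_pick b (insert j T)
      (hb _ ((Finset.card_insert_le _ _).trans (by omega))) i (by simp [hi])
    have hm2 := hm (insert j (T.erase i)) (by simp [hrT, hir.symm]) (by
      rw [Finset.card_insert_of_notMem (by simp [hj]), Finset.card_erase_of_mem hi]
      have := Finset.card_pos.2 ⟨i, hi⟩
      omega)
    have z : ψ (b' r) = 0 := by
      have : Submodule.span F (Set.image b (insert j (T.erase i) : Finset (Fin R))) ≤
          LinearMap.ker ψ := by
        rw [Submodule.span_le]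
        rintro _ ⟨q, hq, rfl⟩
        simp only [Finset.coe_insert, Finset.coe_erase, Set.mem_insert_iff, Set.mem_sdiff,
          Finset.mem_coe, Set.mem_singleton_iff] at hq
        rcases hq with rfl | ⟨hq, hqi⟩
        · exact h2 _ (by simp) hij.symm
        · exact h2 _ (by simp [hq]) hqi
      exact this hm2
    rw [← hβ, map_sum, Finset.sum_eq_single_of_mem i hi] at z
    · simpa [h1] using z
    · intro q hq hqi
      rw [map_smul, h2 q (by simp [hq]) hqi, smul_zero]
  choose β hβ using hβ
  refine ⟨β, fun r => ⟨?_, hβ r, ?_⟩⟩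
  · intro h0
    apply hb'0 r
    rw [hβ, h0, zero_smul]
  · obtain ⟨T, hrT, hTc⟩ := hT r
    obtain ⟨χ, hχ1, hχ2⟩ := pickc T r hTc hrT
    obtain ⟨ψ, h1, h2⟩ := aux_pick b T (hb T (by omega)) r hrT
    apply aux_dual_ext (F := F)
    intro φ
    have e := h φ ψ χ
    simp only [hβ, map_smul, smul_eq_mul] at e
    rw [Finset.sum_eq_single r, Finset.sum_eq_single r, h1, hχ1] at e
    · rw [map_smul, smul_eq_mul]
      linear_combination e
    · intro j _ hji
      by_cases hj : j ∈ T
      · rw [h2 j hj hji]; ring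
      · rw [hχ2 j hj, mul_zero]
    · simp
    · intro j _ hji
      by_cases hj : j ∈ T
      · rw [h2 j hj hji]; ring
      · rw [hχ2 j hj, mul_zero]
    · simp

theorem aux_krank {I R : ℕ} (A : Matrix (Fin I) (Fin R) F) :
    krank A ≤ R ∧ ∀ s : Finset (Fin R), s.card ≤ krank A →
      LinearIndependent F (fun r : {x // x ∈ s} => A.transpose r.1) := by
  have hmem : krank A ∈ {k | k ≤ R ∧ ∀ s : Finset (Fin R), s.card = k →
      LinearIndependent F (fun r : {x // x ∈ s} => A.transpose r.1)} := by
    apply Nat.sSup_mem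
    · refine ⟨0, Nat.zero_le _, ?_⟩
      intro s hs
      rw [Finset.card_eq_zero] at hs
      subst hs
      exact linearIndependent_empty_type
    · exact ⟨R, fun k hk => hk.1⟩
  refine ⟨hmem.1, fun s hs => ?_⟩
  obtain ⟨T, h1, h2, h3⟩ := Finset.exists_subsuperset_card_eq
      (Finset.subset_univ s) hs (by simpa using hmem.1)
  have := hmem.2 T h3
  exact this.comp (fun x : {x // x ∈ s} => (⟨x.1, h1 x.2⟩ : {x // x ∈ T}))
    (fun x y hxy => Subtype.ext (congrArg (fun z => z.1) hxy))

theorem aux_dual_apply {K : ℕ} (φ : Module.Dual F (Fin K → F)) (v : Fin K → F) :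
    φ v = ∑ k, v k * φ (Pi.single k 1) := by
  classical
  conv_lhs => rw [pi_eq_sum_univ' v]
  simp [map_sum]

theorem aux_contract {I J K R : ℕ} (A A' : Matrix (Fin I) (Fin R) F)
    (B B' : Matrix (Fin J) (Fin R) F) (C C' : Matrix (Fin K) (Fin R) F)
    (h : pdTensor A B C = pdTensor A' B' C') (χ : Module.Dual F (Fin K → F)) (i : Fin I)
    (j : Fin J) :
    ∑ r, A i r * B j r * χ (C.transpose r) = ∑ r, A' i r * B' j r * χ (C'.transpose r) := by
  have gen : ∀ (A : Matrix (Fin I) (Fin R) F) (B : Matrix (Fin J) (Fin R) F)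
      (C : Matrix (Fin K) (Fin R) F), ∑ r, A i r * B j r * χ (C.transpose r) =
      ∑ k, pdTensor A B C i j k * χ (Pi.single k 1) := by
    intro A B C
    simp only [aux_dual_apply χ (C.transpose _), pdTensor, Finset.mul_sum, Finset.sum_mul]
    rw [Finset.sum_comm]
    refine Finset.sum_congr rfl fun k _ => Finset.sum_congr rfl fun r _ => ?_
    rw [Matrix.transpose_apply]; ring
  rw [gen, gen, h]

theorem aux_contract3 {I J K R : ℕ} (A A' : Matrix (Fin I) (Fin R) F)
    (B B' : Matrix (Fin J) (Fin R) F) (C C' : Matrix (Fin K) (Fin R) F)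
    (h : pdTensor A B C = pdTensor A' B' C') (φ : Module.Dual F (Fin I → F))
    (ψ : Module.Dual F (Fin J → F)) (χ : Module.Dual F (Fin K → F)) :
    ∑ r, φ (A.transpose r) * ψ (B.transpose r) * χ (C.transpose r) =
      ∑ r, φ (A'.transpose r) * ψ (B'.transpose r) * χ (C'.transpose r) := by
  have gen : ∀ (A : Matrix (Fin I) (Fin R) F) (B : Matrix (Fin J) (Fin R) F)
      (C : Matrix (Fin K) (Fin R) F),
      ∑ r, φ (A.transpose r) * ψ (B.transpose r) * χ (C.transpose r) =
      ∑ i, ∑ j, (∑ r, A i r * B j r * χ (C.transpose r)) *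
        (φ (Pi.single i 1) * ψ (Pi.single j 1)) := by
    intro A B C
    have e : ∀ r, φ (A.transpose r) * ψ (B.transpose r) * χ (C.transpose r) =
        ∑ i, ∑ j, A i r * B j r * χ (C.transpose r) *
          (φ (Pi.single i 1) * ψ (Pi.single j 1)) := by
      intro r
      rw [aux_dual_apply φ (A.transpose r), aux_dual_apply ψ (B.transpose r),
        Finset.sum_mul_sum, Finset.sum_mul]
      refine Finset.sum_congr rfl fun i _ => ?_
      rw [Finset.sum_mul]
      refine Finset.sum_congr rfl fun j _ => ?_
      simp only [Matrix.transpose_apply]; ring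
    rw [Finset.sum_congr rfl fun r _ => e r, Finset.sum_comm]
    refine Finset.sum_congr rfl fun i _ => ?_
    rw [Finset.sum_comm]
    refine Finset.sum_congr rfl fun j _ => ?_
    rw [Finset.sum_mul]
  rw [gen, gen]
  simp only [aux_contract A A' B B' C C' h χ]

theorem aux_rank_bound {I J K R : ℕ} (m : ℕ) (A A' : Matrix (Fin I) (Fin R) F)
    (B B' : Matrix (Fin J) (Fin R) F) (C C' : Matrix (Fin K) (Fin R) F)
    (h : pdTensor A B C = pdTensor A' B' C') (h2 : CondH m A B)
    (χ : Module.Dual F (Fin K → F)) [DecidableEq F] :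
    min (Finset.univ.filter fun r => χ (C.transpose r) ≠ 0).card m ≤
      (Finset.univ.filter fun r => χ (C'.transpose r) ≠ 0).card := by
  set s := Finset.univ.filter fun r => χ (C.transpose r) ≠ 0 with hs
  set d : Fin R → F := fun r => χ (C.transpose r) with hd
  set d' : Fin R → F := fun r => χ (C'.transpose r) with hd'
  rcases Nat.eq_zero_or_pos s.card with h0 | hpos
  · rw [h0]; simp
  have hH := h2 s.card hpos (by simpa using Finset.card_le_univ s) s rfl
  set As := A.submatrix id (fun x : {y // y ∈ s} => x.1) with hAs
  set Bs := B.submatrix id (fun x : {y // y ∈ s} => x.1) with hBs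
  set D : Matrix {y // y ∈ s} {y // y ∈ s} F := Matrix.diagonal fun x => d x.1 with hD
  have hM : As * (D * Bsᵀ) = A' * (Matrix.diagonal d' * B'ᵀ) := by
    ext i j
    have e := aux_contract A A' B B' C C' h χ i j
    rw [Matrix.mul_apply, Matrix.mul_apply]
    simp only [hD, Matrix.diagonal_mul, Matrix.transpose_apply, hAs, hBs, Matrix.submatrix_apply,
      id]
    rw [Finset.sum_coe_sort s (fun r => A i r * (d r * B j r)),
      Finset.sum_subset (Finset.subset_univ s)]
    · calc _ = ∑ r, A i r * B j r * χ (C.transpose r) :=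
            Finset.sum_congr rfl fun r _ => by simp only [hd]; ring
        _ = _ := e
        _ = _ := Finset.sum_congr rfl fun r _ => by simp only [hd']; ring
    · intro r _ hr
      have : d r = 0 := by simpa [hs] using hr
      rw [this]; ring
  have hDdet : D.det ≠ 0 := by
    rw [hD, Matrix.det_diagonal, Finset.prod_ne_zero_iff]
    rintro ⟨x, hx⟩ _
    exact (Finset.mem_filter.1 hx).2
  have r1 : (D * Bsᵀ).rank = Bs.rank := by
    rw [Matrix.rank_mul_eq_right_of_isUnit_det D _ (IsUnit.mk0 _ hDdet), Matrix.rank_transpose]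
  have r2 := aux_sylvester As (D * Bsᵀ)
  rw [r1, hM, Fintype.card_coe] at r2
  have r3 : (A' * (Matrix.diagonal d' * B'ᵀ)).rank ≤
      (Finset.univ.filter fun r => χ (C'.transpose r) ≠ 0).card := by
    refine (Matrix.rank_mul_le_right _ _).trans ((Matrix.rank_mul_le_left _ _).trans ?_)
    rw [Matrix.rank_diagonal, Fintype.card_subtype]
  omega

theorem aux_third {I J K R : ℕ} (A A' : Matrix (Fin I) (Fin R) F)
    (B B' : Matrix (Fin J) (Fin R) F) (C C' : Matrix (Fin K) (Fin R) F)
    (h : pdTensor A B C = pdTensor A' B' C') (h2 : CondH (R - C.rank + 2) A B)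
    (hkC : 2 ≤ krank C) :
    ∃ σ : Equiv.Perm (Fin R), ∃ l : Fin R → F, (∀ r, l r ≠ 0) ∧
      ∀ r, C'.transpose r = l r • C.transpose (σ r) := by
  classical
  have bound := fun χ => aux_rank_bound (R - C.rank + 2) A A' B B' C C' h h2 χ
  have hle : Submodule.span F (Set.range C.transpose) ≤
      Submodule.span F (Set.range C'.transpose) := by
    rw [Submodule.span_le]
    rintro _ ⟨r, rfl⟩
    by_contra hr
    obtain ⟨φ, hφv, hφ⟩ := Submodule.exists_le_ker_of_notMem hr
    have h0 : ∀ s, φ (C'.transpose s) = 0 := fun s => hφ (Submodule.subset_span ⟨s, rfl⟩)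
    have := bound φ
    have hz : (Finset.univ.filter fun r => φ (C'.transpose r) ≠ 0).card = 0 := by
      simp [h0]
    rw [hz] at this
    have hm : 0 < (Finset.univ.filter fun r => φ (C.transpose r) ≠ 0).card :=
      Finset.card_pos.2 ⟨r, by simp [hφv]⟩
    omega
  have hrank : C.rank ≤ finrank F (Submodule.span F (Set.range C'.transpose)) := by
    rw [Matrix.rank_eq_finrank_span_cols]
    exact Submodule.finrank_mono hle
  have hR : finrank F (Submodule.span F (Set.range C'.transpose)) ≤ R := by
    simpa [Set.finrank] using finrank_range_le_card (R := F) C'.transpose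
  apply aux_perm
  · intro r
    have := (aux_krank C).2 {r} (by simp; omega)
    exact this.ne_zero ⟨r, by simp⟩
  · intro r s hrs hmem
    have := (aux_krank C).2 {r, s} (Finset.card_le_two.trans hkC)
    obtain ⟨φ, h1, h3⟩ := aux_pick _ _ this r (by simp)
    obtain ⟨k, hk⟩ := Submodule.mem_span_singleton.1 hmem
    rw [← hk, map_smul, h3 s (by simp) hrs.symm] at h1
    simp at h1
  · intro φ inst hφ
    have := aux_rank_bound (R - C.rank + 2) A A' B B' C C' h h2 φ
    omega

theorem aux_rel_asym {I J K R : ℕ} (A A' : Matrix (Fin I) (Fin R) F)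
    (B B' : Matrix (Fin J) (Fin R) F) (C C' : Matrix (Fin K) (Fin R) F)
    (h : pdTensor A B C = pdTensor A' B' C') (hB' : ∀ r, B'.transpose r ≠ 0)
    (hkC : 2 ≤ krank C)
    (h1 : min (krank A) (krank B - 1) + krank C ≥ R + 1)
    (σ : Equiv.Perm (Fin R)) (l : Fin R → F) (hl0 : ∀ r, l r ≠ 0)
    (hl : ∀ r, C'.transpose r = l r • C.transpose (σ r)) :
    ∃ la lb : Fin R → F, (∀ r, la r * lb r * l r = 1) ∧
      (∀ i r, A' i r = A i (σ r) * la r) ∧ (∀ j r, B' j r = B j (σ r) * lb r) := by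
  have hkR := (aux_krank C).1
  obtain ⟨β, hβ⟩ := aux_step2 (F := F) (t := R + 1 - krank C) (k := krank C) A.transpose
    (fun s => l (σ.symm s) • A'.transpose (σ.symm s)) B.transpose
    (fun s => B'.transpose (σ.symm s)) C.transpose (by omega) hkC hkR (fun r => hB' _)
    (fun s hs => (aux_krank A).2 s (by omega)) (fun s hs => (aux_krank B).2 s (by omega))
    (fun s hs => (aux_krank C).2 s hs) (by
      intro φ ψ χ
      rw [aux_contract3 A A' B B' C C' h φ ψ χ]
      refine Eq.trans ?_ (Equiv.sum_comp σ _)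
      refine Finset.sum_congr rfl fun r _ => ?_
      rw [hl r]
      simp only [Equiv.symm_apply_apply, map_smul, smul_eq_mul]
      ring)
  refine ⟨fun r => (β (σ r) * l r)⁻¹, fun r => β (σ r), fun r => ?_, fun i r => ?_, fun j r => ?_⟩
  · have := (hβ (σ r)).1
    have := hl0 r
    field_simp
  · have h3 := congrFun (hβ (σ r)).2.2 i
    have := (hβ (σ r)).1
    have := hl0 r
    simp only [Equiv.symm_apply_apply, Pi.smul_apply, smul_eq_mul, Matrix.transpose_apply] at h3
    rw [h3]
    field_simp
  · have h3 := congrFun (hβ (σ r)).2.1 j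
    simp only [Equiv.symm_apply_apply, Pi.smul_apply, smul_eq_mul, Matrix.transpose_apply] at h3
    rw [h3, mul_comm]

theorem aux_swap {I J K R : ℕ} (A A' : Matrix (Fin I) (Fin R) F)
    (B B' : Matrix (Fin J) (Fin R) F) (C C' : Matrix (Fin K) (Fin R) F)
    (h : pdTensor A B C = pdTensor A' B' C') : pdTensor B A C = pdTensor B' A' C' := by
  funext j i k
  have := congrFun (congrFun (congrFun h i) j) k
  simp only [pdTensor] at this ⊢
  calc _ = ∑ r, A i r * B j r * C k r := Finset.sum_congr rfl fun r _ => by ring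
    _ = _ := this
    _ = _ := Finset.sum_congr rfl fun r _ => by ring

theorem aux_kC {I J K R : ℕ} (A : Matrix (Fin I) (Fin R) F) (B : Matrix (Fin J) (Fin R) F)
    (C : Matrix (Fin K) (Fin R) F) (hR : 0 < R)
    (h1 : max (min (krank A) (krank B - 1)) (min (krank A - 1) (krank B)) + krank C ≥ R + 1) :
    2 ≤ krank C := by
  have := (aux_krank A).1
  have := (aux_krank B).1
  omega

theorem aux_rel {I J K R : ℕ} (A A' : Matrix (Fin I) (Fin R) F)
    (B B' : Matrix (Fin J) (Fin R) F) (C C' : Matrix (Fin K) (Fin R) F)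
    (h : pdTensor A B C = pdTensor A' B' C') (hA' : ∀ r, A'.transpose r ≠ 0)
    (hB' : ∀ r, B'.transpose r ≠ 0) (hkC : 2 ≤ krank C)
    (h1 : max (min (krank A) (krank B - 1)) (min (krank A - 1) (krank B)) + krank C ≥ R + 1)
    (h2 : CondH (R - C.rank + 2) A B) :
    ∃ σ : Equiv.Perm (Fin R), ∃ la lb lc : Fin R → F,
      (∀ r, la r * lb r * lc r = 1) ∧
      (∀ i r, A' i r = A i (σ r) * la r) ∧
      (∀ j r, B' j r = B j (σ r) * lb r) ∧
      (∀ k r, C' k r = C k (σ r) * lc r) := by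
  obtain ⟨σ, l, hl0, hl⟩ := aux_third A A' B B' C C' h h2 hkC
  have hC : ∀ k r, C' k r = C k (σ r) * l r := by
    intro k r
    have := congrFun (hl r) k
    simp only [Pi.smul_apply, smul_eq_mul, Matrix.transpose_apply] at this
    rw [this, mul_comm]
  rcases le_total (min (krank A - 1) (krank B)) (min (krank A) (krank B - 1)) with hm | hm
  · rw [max_eq_left hm] at h1
    obtain ⟨la, lb, e1, e2, e3⟩ := aux_rel_asym A A' B B' C C' h hB' hkC h1 σ l hl0 hl
    exact ⟨σ, la, lb, l, e1, e2, e3, hC⟩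
  · rw [max_eq_right hm, min_comm] at h1
    obtain ⟨lb, la, e1, e2, e3⟩ := aux_rel_asym B B' A A' C C' (aux_swap A A' B B' C C' h) hA' hkC
      h1 σ l hl0 hl
    exact ⟨σ, la, lb, l, fun r => by rw [mul_comm (la r)]; exact e1 r, e3, e2, hC⟩

theorem aux_pad {I J K R₀ R : ℕ} (hlt : R₀ < R) (A : Matrix (Fin I) (Fin R₀) F)
    (B : Matrix (Fin J) (Fin R₀) F) (C : Matrix (Fin K) (Fin R₀) F) :
    ∃ (A' : Matrix (Fin I) (Fin R) F) (B' : Matrix (Fin J) (Fin R) F)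
      (C' : Matrix (Fin K) (Fin R) F), pdTensor A B C = pdTensor A' B' C' ∧
        ∃ r, C'.transpose r = 0 := by
  obtain ⟨n, rfl⟩ : ∃ n, R = R₀ + (n + 1) := ⟨R - R₀ - 1, by omega⟩
  refine ⟨fun i => Fin.append (A i) 0, fun i => Fin.append (B i) 0, fun i => Fin.append (C i) 0,
    ?_, Fin.natAdd R₀ 0, ?_⟩
  · funext i j k
    simp [pdTensor, Fin.sum_univ_add]
  · funext k
    exact Fin.append_right (C k) 0 0

end Aux

/-- Corollary 1.15: uniqueness of the CPD under (5.1) and (H m_C). -/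
theorem stmt_4 {I J K R : ℕ} (T : Fin I → Fin J → Fin K → F)
    (A : Matrix (Fin I) (Fin R) F) (B : Matrix (Fin J) (Fin R) F) (C : Matrix (Fin K) (Fin R) F)
    (hPD : IsPD T A B C)
    (h1 : max (min (krank A) (krank B - 1)) (min (krank A - 1) (krank B)) + krank C ≥ R + 1)
    (h2 : CondH (R - C.rank + 2) A B) :
    tensorRank T = R ∧ CPDUnique T R := by
  obtain ⟨hA0, hB0, hC0, hT⟩ := hPD
  rcases Nat.eq_zero_or_pos R with hR | hR
  · subst hR
    constructor
    · exact Nat.le_zero.1 (Nat.sInf_le ⟨A, B, C, hA0, hB0, hC0, hT⟩)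
    · intro A₁ A₂ B₁ B₂ C₁ C₂ _ _
      exact ⟨1, fun _ => 1, fun _ => 1, fun _ => 1, fun r => r.elim0, fun _ r => r.elim0,
        fun _ r => r.elim0, fun _ r => r.elim0⟩
  have hkC := aux_kC A B C hR h1
  constructor
  · apply le_antisymm
    · exact Nat.sInf_le ⟨A, B, C, hA0, hB0, hC0, hT⟩
    · refine le_csInf ⟨R, A, B, C, hA0, hB0, hC0, hT⟩ ?_
      rintro R₀ ⟨A₀, B₀, C₀, _, _, _, hT₀⟩
      by_contra hlt
      obtain ⟨A', B', C', e, r, hr⟩ := aux_pad (not_le.1 hlt) A₀ B₀ C₀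
      obtain ⟨σ, l, hl0, hl⟩ := aux_third A A' B B' C C' (by rw [← hT, hT₀, e]) h2 hkC
      rw [hl r] at hr
      exact (smul_ne_zero (hl0 r) (hC0 (σ r))) hr
  · rintro A₁ A₂ B₁ B₂ C₁ C₂ ⟨hA₁, hB₁, hC₁, hT₁⟩ ⟨hA₂, hB₂, hC₂, hT₂⟩
    obtain ⟨σ, a, b, c, p, ea, eb, ec⟩ :=
      aux_rel A A₁ B B₁ C C₁ (hT.symm.trans hT₁) hA₁ hB₁ hkC h1 h2
    obtain ⟨σ', a', b', c', p', ea', eb', ec'⟩ :=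
      aux_rel A A₂ B B₂ C C₂ (hT.symm.trans hT₂) hA₂ hB₂ hkC h1 h2
    have na : ∀ r, a r ≠ 0 := fun r h => by simpa [h] using p r
    have nb : ∀ r, b r ≠ 0 := fun r h => by simpa [h] using p r
    have nc : ∀ r, c r ≠ 0 := fun r h => by simpa [h] using p r
    refine ⟨σ'.trans σ.symm, fun r => a' r / a (σ.symm (σ' r)), fun r => b' r / b (σ.symm (σ' r)),
      fun r => c' r / c (σ.symm (σ' r)), fun r => ?_, fun i r => ?_, fun i r => ?_, fun i r => ?_⟩
    · rw [div_mul_div_comm, div_mul_div_comm, p, p', div_one]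
    · rw [ea, ea', Equiv.trans_apply, Equiv.apply_symm_apply]
      have := na (σ.symm (σ' r))
      field_simp
    · rw [eb, eb', Equiv.trans_apply, Equiv.apply_symm_apply]
      have := nb (σ.symm (σ' r))
      field_simp
    · rw [ec, ec', Equiv.trans_apply, Equiv.apply_symm_apply]
      have := nc (σ.symm (σ' r))
      field_simp
end
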